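/- Let (F_k)_{k=1}^∞ be open subsets of ℝ such that for some 0 < s ≤ 1 and c > 0, liminf_{k→∞} N^s_∞(F_k ∩ C) ≥ c|C|^s for every cylinder C of the expanding map f (which generates a full shift with bounded distortion). Then limsup_k F_k = ⋂_{m=1}^∞ ⋃_{k=m}^∞ F_k belongs to Falconer's class 𝒢^s. -/

import Mathlib

open Set MeasureTheory Filter
open scoped ENNReal Classical

noncomputable section

/-- A similarity transformation of `ℝ`. -/
def IsSimilarity (f : ℝ → ℝ) : Prop := ∃ a b : ℝ, a ≠ 0 ∧ ∀ x, f x = a * x + b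

/-- Falconer's class `𝒢^s`: Gδ sets all of whose images under countably many
similarities intersect in a set of Hausdorff dimension at least `s`. -/
def falconerClass (s : ℝ) : Set (Set ℝ) :=
  {F | IsGδ F ∧ ∀ T : ℕ → ℝ → ℝ, (∀ i, IsSimilarity (T i)) →
    ENNReal.ofReal s ≤ dimH (⋂ i, T i '' F)}

/-- A probability vector indexed by a finite type. -/
def IsProbVector {ι : Type*} [Fintype ι] (p : ι → ℝ) : Prop :=
  (∀ i, 0 ≤ p i) ∧ ∑ i, p i = 1

/-- A dyadic half-open interval `[2^k m, 2^k (m+1))`. -/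
def IsDyadic (I : Set ℝ) : Prop :=
  ∃ (k m : ℤ), I = Ico ((2:ℝ) ^ k * m) ((2:ℝ) ^ k * (m + 1))

/-- The outer measure `M^s_∞` obtained from countable covers by dyadic intervals. -/
def dyadicMeasure (s : ℝ) (A : Set ℝ) : ℝ≥0∞ :=
  ⨅ (I : ℕ → Set ℝ) (_ : ∀ i, IsDyadic (I i)) (_ : A ⊆ ⋃ i, I i),
    ∑' i, volume (I i) ^ s

/-- Extension of a subset of `[0,1)` to `ℝ` by integer translations. -/
def periodize (A : Set ℝ) : Set ℝ := ⋃ k : ℤ, (fun x => x + (k : ℝ)) '' A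

/-- An expanding interval map on `[0,1)` with `g` full monotone branches,
generating a full shift on `g` symbols. -/
structure ExpandingFullShift where
  g : ℕ
  one_lt_g : 1 < g
  branch : Fin g → Set ℝ
  branch_Ico : ∀ i, ∃ a b : ℝ, a < b ∧ branch i = Ico a b
  branch_cover : (⋃ i, branch i) = Ico (0:ℝ) 1
  branch_disjoint : ∀ i j, i ≠ j → Disjoint (branch i) (branch j)
  f : ℝ → ℝ
  f_onto : ∀ i, f '' branch i = Ico (0:ℝ) 1
  f_mono : ∀ i, StrictMonoOn f (branch i) ∨ StrictAntiOn f (branch i)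
  f_expanding : ∀ i, ∀ x ∈ branch i, ∀ y ∈ branch i, |x - y| ≤ |f x - f y|

namespace ExpandingFullShift

variable (E : ExpandingFullShift)

/-- The symbol `0`. -/
def zeroSym : Fin E.g := ⟨0, Nat.lt_trans Nat.one_pos E.one_lt_g⟩

/-- The cylinder `C_{x₁ … x_n} ⊆ [0,1)` determined by a word `w`. -/
def cylinder (w : List (Fin E.g)) : Set ℝ :=
  {x ∈ Ico (0:ℝ) 1 | ∀ k (hk : k < w.length), E.f^[k] x ∈ E.branch (w.get ⟨k, hk⟩)}

/-- A cylinder in some interval `[k, k+1)`, `k ∈ ℤ` (periodic extension of the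
cylinder structure to `ℝ`). -/
def IsCylinderZ (C : Set ℝ) : Prop :=
  ∃ (w : List (Fin E.g)) (k : ℤ), C = (fun x => x + (k : ℝ)) '' E.cylinder w

/-- The outer measure `N^s_∞` obtained from countable covers by cylinders of `E`. -/
def cylMeasure (s : ℝ) (A : Set ℝ) : ℝ≥0∞ :=
  ⨅ (c : ℕ → List (Fin E.g)) (_ : A ⊆ ⋃ i, E.cylinder (c i)),
    ∑' i, volume (E.cylinder (c i)) ^ s

/-- The outer measure `N^s_∞` from covers by cylinders of the periodic extension. -/
def cylMeasureZ (s : ℝ) (A : Set ℝ) : ℝ≥0∞ :=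
  ⨅ (c : ℕ → Set ℝ) (_ : ∀ i, E.IsCylinderZ (c i)) (_ : A ⊆ ⋃ i, c i),
    ∑' i, volume (c i) ^ s

/-- The empirical frequency `τ^f_w(x,n)/(n-m)` of the word `w` (of length `m`)
in the first `n` symbols of the expansion of `x`. -/
def freq {m : ℕ} (w : Fin m → Fin E.g) (x : ℝ) (n : ℕ) : ℝ :=
  (((Finset.range (n - m)).filter
      (fun i => ∀ k : Fin m, E.f^[i + k] x ∈ E.branch (w k))).card : ℝ) / ((n - m : ℕ) : ℝ)

/-- `G^{f,m}_{p̄}`: the set of points whose length-`m` word frequencies converge to `p̄`. -/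
def Gset (m : ℕ) (p : (Fin m → Fin E.g) → ℝ) : Set ℝ :=
  {x ∈ Ico (0:ℝ) 1 | ∀ w : Fin m → Fin E.g,
    Tendsto (fun n => E.freq w x n) atTop (nhds (p w))}

/-- `G^{f,m}_{p̄}(n,ε)`: points whose empirical length-`m` word frequencies at time `n`
are within `ε` of `p̄` componentwise. -/
def GsetApprox (m : ℕ) (p : (Fin m → Fin E.g) → ℝ) (n : ℕ) (ε : ℝ) : Set ℝ :=
  {x ∈ Ico (0:ℝ) 1 | ∀ w : Fin m → Fin E.g, |E.freq w x n - p w| < ε}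

/-- `p̄ ∈ A^{f,m}(x)`: the vector `p̄` is an accumulation point of the empirical
frequency vectors of `x` as `n → ∞`. -/
def IsFreqAccum (m : ℕ) (p : (Fin m → Fin E.g) → ℝ) (x : ℝ) : Prop :=
  MapClusterPt p atTop (fun n => fun w => E.freq w x n)

/-- `x` is `m`-normal to `f`: every length-`m` word occurs with frequency equal to
the length of the corresponding cylinder. -/
def IsNormal (m : ℕ) (x : ℝ) : Prop :=
  ∀ w : Fin m → Fin E.g,
    Tendsto (fun n => E.freq w x n) atTop (nhds (volume (E.cylinder (List.ofFn w))).toReal)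

/-- Bounded distortion with constant `K`:
`|C_u||C_v|/K ≤ |C_{uv}| ≤ K |C_u||C_v|` for all words `u, v`. -/
def HasBoundedDistortion (K : ℝ) : Prop :=
  ∀ u v : List (Fin E.g),
    volume (E.cylinder (u ++ v)) ≤
      ENNReal.ofReal K * (volume (E.cylinder u) * volume (E.cylinder v)) ∧
    volume (E.cylinder u) * volume (E.cylinder v) ≤
      ENNReal.ofReal K * volume (E.cylinder (u ++ v))

/-- Condition (ii): for each `m` there is `p̄` with `dim_H G^{f,m}_{p̄} = 1`, and for
each word `w` of length `m` there are vectors `q̄` with `q_w ≠ p_w` whose `G`-set has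
Hausdorff dimension arbitrarily close to `1`. -/
def CondII : Prop :=
  ∀ m : ℕ, 0 < m → ∃ p : (Fin m → Fin E.g) → ℝ, IsProbVector p ∧ dimH (E.Gset m p) = 1 ∧
    ∀ w : Fin m → Fin E.g, ∀ t : ℝ≥0∞, t < 1 → ∃ q : (Fin m → Fin E.g) → ℝ,
      IsProbVector q ∧ q w ≠ p w ∧ t ≤ dimH (E.Gset m q)

end ExpandingFullShift

/-- The parent-level weights of the dyadic tree: two siblings contribute `q` times their
total weight, capped at `1`. -/
def levelUp (q : ℝ) (u : ℤ → ℝ) (k : ℤ) : ℝ := min 1 (q * (u (2 * k) + u (2 * k + 1)))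

namespace levelUp

variable {q : ℝ}

theorem mono (hq : 0 ≤ q) : Monotone (levelUp q) := by
  intro u v huv k
  unfold levelUp
  have h1 := huv (2 * k)
  have h2 := huv (2 * k + 1)
  gcongr

theorem iterate_mono (hq : 0 ≤ q) (n : ℕ) : Monotone (levelUp q)^[n] :=
  (mono hq).iterate n

theorem nonneg (hq : 0 ≤ q) {u : ℤ → ℝ} (hu : 0 ≤ u) : 0 ≤ levelUp q u := by
  intro k
  have h1 : 0 ≤ u (2 * k) := hu _
  have h2 : 0 ≤ u (2 * k + 1) := hu _
  exact le_min zero_le_one (by positivity)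

theorem iterate_nonneg (hq : 0 ≤ q) {u : ℤ → ℝ} (hu : 0 ≤ u) (n : ℕ) :
    0 ≤ (levelUp q)^[n] u := by
  induction n with
  | zero => exact hu
  | succ n ih =>
    rw [Function.iterate_succ_apply']
    exact nonneg hq ih

theorem iterate_le_one {u : ℤ → ℝ} (hu : u ≤ 1) (n : ℕ) : (levelUp q)^[n] u ≤ 1 := by
  cases n with
  | zero => exact hu
  | succ n =>
    rw [Function.iterate_succ_apply']
    exact fun k => min_le_left _ _

theorem smul_le {r : ℝ} (hr0 : 0 ≤ r) (hr1 : r ≤ 1) (u : ℤ → ℝ) :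
    r • levelUp q u ≤ levelUp q (r • u) := by
  intro k
  simp only [levelUp, Pi.smul_apply, smul_eq_mul]
  rw [mul_min_of_nonneg _ _ hr0]
  refine le_min ((min_le_left _ _).trans (by linarith)) ((min_le_right _ _).trans (le_of_eq ?_))
  ring

theorem smul_iterate_le (hq : 0 ≤ q) {r : ℝ} (hr0 : 0 ≤ r) (hr1 : r ≤ 1) (u : ℤ → ℝ) (n : ℕ) :
    r • (levelUp q)^[n] u ≤ (levelUp q)^[n] (r • u) := by
  induction n with
  | zero => exact le_rfl
  | succ n ih =>
    simp only [Function.iterate_succ_apply']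
    exact (smul_le hr0 hr1 _).trans (mono hq ih)

theorem add_le (hq : 0 ≤ q) {u v : ℤ → ℝ} (hu : 0 ≤ u) (hv : 0 ≤ v) :
    levelUp q (u + v) ≤ levelUp q u + levelUp q v := by
  intro k
  have h1 : 0 ≤ u (2 * k) := hu _
  have h2 : 0 ≤ u (2 * k + 1) := hu _
  have h3 : 0 ≤ v (2 * k) := hv _
  have h4 : 0 ≤ v (2 * k + 1) := hv _
  have h5 : 0 ≤ q * (u (2 * k) + u (2 * k + 1)) := by positivity
  have h6 : 0 ≤ q * (v (2 * k) + v (2 * k + 1)) := by positivity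
  simp only [levelUp, Pi.add_apply]
  have h7 : q * (u (2 * k) + v (2 * k) + (u (2 * k + 1) + v (2 * k + 1))) =
    q * (u (2 * k) + u (2 * k + 1)) + q * (v (2 * k) + v (2 * k + 1)) := by ring
  rw [h7]
  rcases min_cases 1 (q * (u (2 * k) + u (2 * k + 1))) with h | h <;>
  rcases min_cases 1 (q * (v (2 * k) + v (2 * k + 1))) with h' | h' <;>
  rw [h.1, h'.1] <;>
  first
  | exact (min_le_left _ _).trans (by linarith)
  | exact (min_le_right _ _).trans (by linarith)

theorem iterate_add_le (hq : 0 ≤ q) {u v : ℤ → ℝ} (hu : 0 ≤ u) (hv : 0 ≤ v) (n : ℕ) :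
    (levelUp q)^[n] (u + v) ≤ (levelUp q)^[n] u + (levelUp q)^[n] v := by
  induction n with
  | zero => exact le_rfl
  | succ n ih =>
    simp only [Function.iterate_succ_apply']
    exact (mono hq ih).trans (add_le hq (iterate_nonneg hq hu n) (iterate_nonneg hq hv n))

theorem iterate_zero_fun (n : ℕ) : (levelUp q)^[n] 0 = 0 := by
  induction n with
  | zero => rfl
  | succ n ih =>
    rw [Function.iterate_succ_apply', ih]
    funext k
    simp [levelUp]

theorem iterate_sum_le (hq : 0 ≤ q) {ι : Type*} (s : Finset ι) {u : ι → ℤ → ℝ}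
    (hu : ∀ i, 0 ≤ u i) (n : ℕ) :
    (levelUp q)^[n] (∑ i ∈ s, u i) ≤ ∑ i ∈ s, (levelUp q)^[n] (u i) := by
  induction s using Finset.induction_on with
  | empty => simp [iterate_zero_fun]
  | insert a s ha ih =>
    rw [Finset.sum_insert ha, Finset.sum_insert ha]
    refine (iterate_add_le hq (hu a) (Finset.sum_nonneg fun i _ => hu i) n).trans ?_
    gcongr

theorem iterate_congr {u v : ℤ → ℝ} (n : ℕ) :
    ∀ k : ℤ, (∀ j : ℤ, j / 2 ^ n = k → u j = v j) →
      (levelUp q)^[n] u k = (levelUp q)^[n] v k := by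
  induction n with
  | zero => intro k h; exact h k (by simp)
  | succ n ih =>
    intro k h
    simp only [Function.iterate_succ_apply', levelUp]
    have key : ∀ j : ℤ, j / 2 ^ (n + 1) = j / 2 ^ n / 2 := by
      intro j
      rw [pow_succ, Int.ediv_ediv_of_nonneg (by positivity)]
    rw [ih (2 * k), ih (2 * k + 1)]
    · intro j hj
      refine h j ?_
      rw [key, hj]
      omega
    · intro j hj
      refine h j ?_
      rw [key, hj]
      omega

/-- The weight spread from a node to its descendants `a` levels below comes back as at most the
unit weight of the node. -/
theorem iterate_descendants_le (hq : 0 ≤ q) (p : ℤ) (a : ℕ) :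
    (levelUp q)^[a] (fun k => if k / 2 ^ a = p then 1 else 0) ≤
      fun k => if k = p then 1 else 0 := by
  induction a with
  | zero => intro k; simp
  | succ a ih =>
    rw [Function.iterate_succ_apply]
    refine le_trans (iterate_mono hq a ?_) ih
    intro k
    have h1 : (2 * k) / (2 ^ (a + 1) : ℤ) = k / 2 ^ a := by
      rw [pow_succ', Int.mul_ediv_mul_of_pos _ _ (by norm_num)]
    have h2 : (2 * k + 1) / (2 ^ (a + 1) : ℤ) = k / 2 ^ a := by
      rw [pow_succ', ← Int.ediv_ediv_of_nonneg (by norm_num)]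
      congr 1
      omega
    simp only [levelUp, h1, h2]
    split_ifs
    · exact min_le_left _ _
    · simp

theorem single_le (hq : 0 ≤ q) {c : ℝ} (hc : 0 ≤ c) (p : ℤ) :
    levelUp q (fun k => if k = p then c else 0) ≤ fun k => if k = p / 2 then q * c else 0 := by
  intro k
  simp only [levelUp]
  refine (min_le_right _ _).trans ?_
  have hqc : 0 ≤ q * c := mul_nonneg hq hc
  by_cases h1 : 2 * k = p
  · rw [if_pos h1, if_neg (by omega), if_pos (by omega), add_zero]
  · by_cases h2 : 2 * k + 1 = p
    · rw [if_neg h1, if_pos h2, if_pos (by omega), zero_add]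
    · rw [if_neg h1, if_neg h2]
      split_ifs <;> simp [hqc]

theorem iterate_single_le (hq : 0 ≤ q) (n : ℕ) : ∀ {c : ℝ} (_ : 0 ≤ c) (p r : ℤ),
    (levelUp q)^[n] (fun k => if k = p then c else 0) r ≤ q ^ n * c := by
  induction n with
  | zero =>
    intro c hc p r
    simp only [Function.iterate_zero, id, pow_zero, one_mul]
    split_ifs <;> simp [hc]
  | succ n ih =>
    intro c hc p r
    rw [Function.iterate_succ_apply]
    refine (iterate_mono hq n (single_le hq hc p) r).trans ?_
    refine (ih (mul_nonneg hq hc) (p / 2) r).trans (le_of_eq ?_)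
    ring

theorem iterate_descendants_le_pow (hq : 0 ≤ q) {n N : ℕ} (h : n ≤ N) (p r : ℤ) :
    (levelUp q)^[N] (fun k => if k / 2 ^ (N - n) = p then 1 else 0) r ≤ q ^ n := by
  obtain ⟨a, rfl⟩ := Nat.exists_eq_add_of_le h
  rw [Nat.add_sub_cancel_left, Function.iterate_add_apply]
  refine (iterate_mono hq n (iterate_descendants_le hq p a) r).trans ?_
  simpa using iterate_single_le hq n zero_le_one p r

end levelUp

/-- The half-open dyadic interval `[k / 2 ^ n, (k + 1) / 2 ^ n)`. -/
def dyadicCell (n : ℕ) (k : ℤ) : Set ℝ := {x | ⌊x * 2 ^ n⌋ = k}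

/-- The closed dyadic interval `[k / 2 ^ n, (k + 1) / 2 ^ n]`. -/
def closedDyadicCell (n : ℕ) (k : ℤ) : Set ℝ := Icc (k / 2 ^ n) ((k + 1) / 2 ^ n)

theorem floor_mul_two_pow_add (x : ℝ) (n a : ℕ) :
    ⌊x * 2 ^ n⌋ = ⌊x * 2 ^ (n + a)⌋ / 2 ^ a := by
  have h := Int.floor_div_natCast (x * 2 ^ (n + a)) (2 ^ a)
  push_cast at h
  rw [← h, pow_add, ← mul_assoc, mul_div_assoc, div_self (by positivity), mul_one]

theorem dyadicCell_eq_union (n : ℕ) (k : ℤ) :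
    dyadicCell n k = dyadicCell (n + 1) (2 * k) ∪ dyadicCell (n + 1) (2 * k + 1) := by
  ext x
  simp only [dyadicCell, mem_ofPred_eq, mem_union]
  have := floor_mul_two_pow_add x n 1
  omega

theorem abs_sub_le_of_mem_dyadicCell {n : ℕ} {k : ℤ} {x y : ℝ} (hx : x ∈ dyadicCell n k)
    (hy : y ∈ dyadicCell n k) : |x - y| ≤ (1 / 2) ^ n := by
  have h := (Int.abs_sub_lt_one_of_floor_eq_floor (hx.trans (Eq.symm hy))).le
  rw [← sub_mul, abs_mul, abs_of_pos (by positivity : (0:ℝ) < 2 ^ n)] at h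
  rw [one_div, inv_pow, ← one_div, le_div_iff₀ (by positivity)]
  exact h

theorem ediam_dyadicCell_le (n : ℕ) (k : ℤ) :
    Metric.ediam (dyadicCell n k) ≤ ENNReal.ofReal ((1 / 2) ^ n) := by
  refine Metric.ediam_le fun x hx y hy => ?_
  rw [edist_dist, Real.dist_eq]
  exact ENNReal.ofReal_le_ofReal (abs_sub_le_of_mem_dyadicCell hx hy)

theorem closedDyadicCell_subset (n a : ℕ) (k : ℤ) :
    closedDyadicCell (n + a) k ⊆ closedDyadicCell n (k / 2 ^ a) := by
  have hpos : (0:ℝ) < 2 ^ n := by positivity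
  have hposa : (0:ℝ) < 2 ^ a := by positivity
  have h1 : k / 2 ^ a * 2 ^ a ≤ k := Int.ediv_mul_le _ (by positivity)
  have h2 : k < (k / 2 ^ a + 1) * 2 ^ a := Int.lt_ediv_add_one_mul_self _ (by positivity)
  have h2' : k + 1 ≤ (k / 2 ^ a + 1) * 2 ^ a := h2
  have h1r : ((k / 2 ^ a : ℤ) : ℝ) * 2 ^ a ≤ k := by exact_mod_cast h1
  have h2r : (k : ℝ) + 1 ≤ (((k / 2 ^ a : ℤ) : ℝ) + 1) * 2 ^ a := by exact_mod_cast h2'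
  refine Icc_subset_Icc ?_ ?_
  · rw [div_le_div_iff₀ hpos (by positivity), pow_add]
    nlinarith
  · rw [div_le_div_iff₀ (by positivity) hpos, pow_add]
    nlinarith

theorem mem_closedDyadicCell_floor (x : ℝ) (n : ℕ) :
    x ∈ closedDyadicCell n ⌊x * 2 ^ n⌋ := by
  refine ⟨?_, ?_⟩
  · rw [div_le_iff₀ (by positivity)]
    exact Int.floor_le _
  · rw [le_div_iff₀ (by positivity)]
    exact (Int.lt_floor_add_one _).le

theorem exists_closedDyadicCell_subset {V : Set ℝ} (hV : IsOpen V) {x : ℝ} (hx : x ∈ V) (n : ℕ) :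
    ∃ a, closedDyadicCell (n + a) ⌊x * 2 ^ (n + a)⌋ ⊆ V := by
  obtain ⟨ε, hε, hball⟩ := Metric.isOpen_iff.1 hV x hx
  obtain ⟨a, ha⟩ := exists_pow_lt_of_lt_one hε (by norm_num : (1 / 2 : ℝ) < 1)
  refine ⟨a, fun y hy => hball ?_⟩
  have hx' := mem_closedDyadicCell_floor x (n + a)
  have hle : (1 / 2 : ℝ) ^ (n + a) ≤ (1 / 2) ^ a :=
    pow_le_pow_of_le_one (by norm_num) (by norm_num) (Nat.le_add_left _ _)
  have hd := abs_sub_le_of_uIcc_subset_uIcc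
    (uIcc_subset_uIcc (Icc_subset_uIcc hx') (Icc_subset_uIcc hy))
  rw [Metric.mem_ball, Real.dist_eq]
  refine hd.trans_lt (lt_of_eq_of_lt ?_ (hle.trans_lt ha))
  rw [← sub_div, add_sub_cancel_left, abs_of_pos (by positivity), one_div, one_div, inv_pow]

/-- The `t`-dimensional Hausdorff content on `ℝ`. -/
def hausdorffContent (t : ℝ) : OuterMeasure ℝ :=
  ⨅ _ : 0 < t, OuterMeasure.ofFunction (fun A : Set ℝ => if A = ∅ then 0 else Metric.ediam A ^ t)
    (by simp)

theorem hausdorffContent_eq {t : ℝ} (ht : 0 < t) (A : Set ℝ) :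
    hausdorffContent t A =
      ⨅ (U : ℕ → Set ℝ) (_ : A ⊆ ⋃ i, U i), ∑' i, Metric.ediam (U i) ^ t := by
  have h : (fun A : Set ℝ => if A = ∅ then 0 else Metric.ediam A ^ t) =
      fun A => Metric.ediam A ^ t := by
    funext A
    split_ifs with hA
    · simp [hA, ht]
    · rfl
  simp only [hausdorffContent, iInf_pos ht, OuterMeasure.ofFunction_apply, h]

theorem hausdorffContent_le_ediam {t : ℝ} (ht : 0 < t) (A : Set ℝ) :
    hausdorffContent t A ≤ Metric.ediam A ^ t := by
  rw [hausdorffContent, iInf_pos ht]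
  refine (OuterMeasure.ofFunction_le A).trans ?_
  split_ifs
  · exact zero_le
  · exact le_rfl

theorem hausdorffContent_le_hausdorffMeasure {t : ℝ} (ht : 0 < t) (A : Set ℝ) :
    hausdorffContent t A ≤ μH[t] A := by
  rw [Measure.hausdorffMeasure_apply, hausdorffContent_eq ht]
  refine le_iSup₂_of_le 1 one_pos ?_
  refine le_iInf₂ fun U hU => le_iInf fun _ => ?_
  refine (iInf₂_le U hU).trans (ENNReal.tsum_le_tsum fun i => ?_)
  rcases (U i).eq_empty_or_nonempty with h | h
  · simp [h, ht]
  · simp [h]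

theorem hausdorffContent_dyadicCell_le {t : ℝ} (ht : 0 < t) (n : ℕ) (k : ℤ) :
    hausdorffContent t (dyadicCell n k) ≤ ENNReal.ofReal (((1 / 2) ^ t) ^ n) := by
  refine (hausdorffContent_le_ediam ht _).trans ?_
  rw [Real.rpow_pow_comm (by norm_num), ← ENNReal.ofReal_rpow_of_pos (by positivity)]
  exact ENNReal.rpow_le_rpow (ediam_dyadicCell_le n k) ht.le

/-- Union of the cells that are exactly `d` levels below `(n, k)` and maximal among those
where `ψ = 1`. -/
def maximalCells (ψ : ℕ → ℤ → ℝ) : ℕ → ℕ → ℤ → Set ℝ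
  | 0, n, k => if ψ n k = 1 then dyadicCell n k else ∅
  | d + 1, n, k => if ψ n k = 1 then ∅ else
      maximalCells ψ d (n + 1) (2 * k) ∪ maximalCells ψ d (n + 1) (2 * k + 1)

/-- The normalized cost of `maximalCells`. -/
def maximalCost (q : ℝ) (ψ : ℕ → ℤ → ℝ) : ℕ → ℕ → ℤ → ℝ
  | 0, n, k => if ψ n k = 1 then 1 else 0
  | d + 1, n, k => if ψ n k = 1 then 0 else
      q * (maximalCost q ψ d (n + 1) (2 * k) + maximalCost q ψ d (n + 1) (2 * k + 1))

theorem maximalCost_nonneg {q : ℝ} (hq : 0 ≤ q) (ψ : ℕ → ℤ → ℝ) (d : ℕ) :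
    ∀ n k, 0 ≤ maximalCost q ψ d n k := by
  induction d with
  | zero => intro n k; simp only [maximalCost]; split_ifs <;> simp
  | succ d ih =>
    intro n k
    have h1 := ih (n + 1) (2 * k)
    have h2 := ih (n + 1) (2 * k + 1)
    simp only [maximalCost]
    split_ifs
    · exact le_rfl
    · positivity

theorem sum_maximalCost_le {q : ℝ} (hq : 0 ≤ q) {ψ : ℕ → ℤ → ℝ} (h0 : ∀ n k, 0 ≤ ψ n k)
    (hψ : ∀ n k, ψ n k ≠ 1 → q * (ψ (n + 1) (2 * k) + ψ (n + 1) (2 * k + 1)) ≤ ψ n k) (m : ℕ) :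
    ∀ n k, ∑ d ∈ Finset.range m, maximalCost q ψ d n k ≤ ψ n k := by
  induction m with
  | zero => intro n k; simpa using h0 n k
  | succ m ih =>
    intro n k
    rw [Finset.sum_range_succ']
    by_cases h : ψ n k = 1
    · simp [maximalCost, h]
    · simp only [maximalCost, h, if_false, add_zero, ← Finset.mul_sum, Finset.sum_add_distrib]
      refine le_trans ?_ (hψ n k h)
      have h1 := ih (n + 1) (2 * k)
      have h2 := ih (n + 1) (2 * k + 1)
      gcongr

theorem measure_maximalCells_le {q : ℝ} (hq : 0 ≤ q) (ψ : ℕ → ℤ → ℝ) {μ : OuterMeasure ℝ}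
    (hμ : ∀ n k, μ (dyadicCell n k) ≤ ENNReal.ofReal (q ^ n)) (d : ℕ) :
    ∀ n k, μ (maximalCells ψ d n k) ≤ ENNReal.ofReal (q ^ n * maximalCost q ψ d n k) := by
  induction d with
  | zero =>
    intro n k
    simp only [maximalCells, maximalCost]
    split_ifs
    · simpa using hμ n k
    · simp
  | succ d ih =>
    intro n k
    simp only [maximalCells, maximalCost]
    split_ifs
    · simp
    · refine (measure_union_le _ _).trans ((add_le_add (ih _ _) (ih _ _)).trans (le_of_eq ?_))
      have h1 := maximalCost_nonneg hq ψ d (n + 1) (2 * k)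
      have h2 := maximalCost_nonneg hq ψ d (n + 1) (2 * k + 1)
      rw [← ENNReal.ofReal_add (by positivity) (by positivity)]
      congr 1
      ring

theorem exists_mem_maximalCells {ψ : ℕ → ℤ → ℝ} {x : ℝ} (d : ℕ) :
    ∀ n k, x ∈ dyadicCell n k → ψ (n + d) ⌊x * 2 ^ (n + d)⌋ = 1 →
      ∃ e, x ∈ maximalCells ψ e n k := by
  induction d with
  | zero =>
    intro n k hx h
    have hk : ⌊x * 2 ^ n⌋ = k := hx
    refine ⟨0, ?_⟩
    rw [add_zero, hk] at h
    simpa [maximalCells, h] using hx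
  | succ d ih =>
    intro n k hx h
    by_cases h1 : ψ n k = 1
    · exact ⟨0, by simpa [maximalCells, h1] using hx⟩
    rw [show n + (d + 1) = n + 1 + d by ring] at h
    rw [dyadicCell_eq_union] at hx
    rcases hx with hx | hx <;> obtain ⟨e, he⟩ := ih _ _ hx h <;> refine ⟨e + 1, ?_⟩ <;>
    simp [maximalCells, h1, he]

/-- A supersolution of the capped recursion dominates the content of the set of points lying in
arbitrarily deep cells of full weight. -/
theorem measure_le_of_supersolution {q : ℝ} (hq : 0 ≤ q) {ψ : ℕ → ℤ → ℝ}
    (h0 : ∀ n k, 0 ≤ ψ n k)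
    (hψ : ∀ n k, ψ n k ≠ 1 → q * (ψ (n + 1) (2 * k) + ψ (n + 1) (2 * k + 1)) ≤ ψ n k)
    {μ : OuterMeasure ℝ} (hμ : ∀ n k, μ (dyadicCell n k) ≤ ENNReal.ofReal (q ^ n))
    {V : Set ℝ} (hV : ∀ x ∈ V, ∀ n, ∃ d, ψ (n + d) ⌊x * 2 ^ (n + d)⌋ = 1) (n : ℕ) (k : ℤ) :
    μ (V ∩ dyadicCell n k) ≤ ENNReal.ofReal (q ^ n * ψ n k) := by
  have hsub : V ∩ dyadicCell n k ⊆ ⋃ d, maximalCells ψ d n k := by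
    rintro x ⟨hxV, hx⟩
    obtain ⟨d, hd⟩ := hV x hxV n
    exact mem_iUnion.2 (exists_mem_maximalCells d n k hx hd)
  refine (measure_mono hsub).trans ((measure_iUnion_le _).trans ?_)
  refine ENNReal.tsum_le_of_sum_range_le fun m => ?_
  refine (Finset.sum_le_sum fun d _ => measure_maximalCells_le hq ψ hμ d n k).trans ?_
  rw [← ENNReal.ofReal_sum_of_nonneg]
  · refine ENNReal.ofReal_le_ofReal ?_
    rw [← Finset.mul_sum]
    have := sum_maximalCost_le hq h0 hψ m n k
    gcongr
  · intro d _
    have := maximalCost_nonneg hq ψ d n k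
    positivity

/-- Indicator of the closed dyadic cells of generation `n` contained in `V`. -/
def cellIndicator (V : Set ℝ) (n : ℕ) (k : ℤ) : ℝ := if closedDyadicCell n k ⊆ V then 1 else 0

theorem cellIndicator_nonneg (V : Set ℝ) (n : ℕ) : 0 ≤ cellIndicator V n := by
  intro k
  simp only [cellIndicator]
  split_ifs <;> simp

theorem cellIndicator_le_one (V : Set ℝ) (n : ℕ) : cellIndicator V n ≤ 1 := by
  intro k
  simp only [cellIndicator]
  split_ifs <;> simp

theorem cellIndicator_le_levelUp {q : ℝ} (hq : 1 < 2 * q) (V : Set ℝ) (n : ℕ) :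
    cellIndicator V n ≤ levelUp q (cellIndicator V (n + 1)) := by
  intro k
  by_cases h : closedDyadicCell n k ⊆ V
  · have h1 : closedDyadicCell (n + 1) (2 * k) ⊆ V := by
      refine (closedDyadicCell_subset n 1 (2 * k)).trans ?_
      rwa [show 2 * k / 2 ^ 1 = k by omega]
    have h2 : closedDyadicCell (n + 1) (2 * k + 1) ⊆ V := by
      refine (closedDyadicCell_subset n 1 (2 * k + 1)).trans ?_
      rwa [show (2 * k + 1) / 2 ^ 1 = k by omega]
    simp only [cellIndicator, levelUp, h, h1, h2, if_true]
    exact le_min le_rfl (by linarith)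
  · have := levelUp.nonneg (q := q) (by linarith) (cellIndicator_nonneg V (n + 1)) k
    simpa [cellIndicator, h] using this

/-- If an open set has content bounded below proportionally in each dyadic cell, then finite
unions of closed cells inside it have almost full weight in every cell. -/
theorem exists_iterate_cellIndicator_gt {t : ℝ} (ht0 : 0 < t) (ht1 : t < 1) {V : Set ℝ}
    (hV : IsOpen V) {a : ℝ} (ha : 0 < a)
    (hcont : ∀ n k, ENNReal.ofReal (a * ((1 / 2) ^ t) ^ n) ≤
      hausdorffContent t (V ∩ dyadicCell n k))
    (n : ℕ) (k : ℤ) {r : ℝ} (hr : r < 1) :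
    ∀ᶠ h in atTop, r < (levelUp ((1 / 2) ^ t))^[h] (cellIndicator V (n + h)) k := by
  set q : ℝ := (1 / 2) ^ t with hqdef
  have hq0 : 0 < q := by positivity
  have hq1 : 1 < 2 * q := by
    have : (1 / 2 : ℝ) ^ (1:ℝ) < (1 / 2) ^ t :=
      Real.rpow_lt_rpow_of_exponent_gt (by norm_num) (by norm_num) ht1
    rw [Real.rpow_one] at this
    linarith
  set φ : ℕ → ℕ → ℤ → ℝ := fun h n => (levelUp q)^[h] (cellIndicator V (n + h)) with hφ
  have hφmono : ∀ n k, Monotone fun h => φ h n k := by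
    intro n k
    refine monotone_nat_of_le_succ fun h => ?_
    simp only [hφ]
    rw [Function.iterate_succ_apply]
    exact levelUp.iterate_mono hq0.le h (cellIndicator_le_levelUp hq1 V (n + h)) k
  have hφ1 : ∀ h n k, φ h n k ≤ 1 := fun h n k =>
    levelUp.iterate_le_one (cellIndicator_le_one V _) h k
  have hbdd : ∀ n k, BddAbove (range fun h => φ h n k) := fun n k =>
    ⟨1, by rintro _ ⟨h, rfl⟩; exact hφ1 h n k⟩
  set ψ : ℕ → ℤ → ℝ := fun n k => ⨆ h, φ h n k with hψdef
  have hlim : ∀ n k, Tendsto (fun h => φ h n k) atTop (nhds (ψ n k)) := fun n k =>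
    tendsto_atTop_ciSup (hφmono n k) (hbdd n k)
  have hψ1 : ∀ n k, ψ n k ≤ 1 := fun n k => ciSup_le fun h => hφ1 h n k
  have hψ0 : ∀ n k, 0 ≤ ψ n k := fun n k =>
    (levelUp.iterate_nonneg hq0.le (cellIndicator_nonneg V (n + 0)) 0 k).trans
      (le_ciSup (hbdd n k) 0)
  have hrec : ∀ n k, ψ n k = min 1 (q * (ψ (n + 1) (2 * k) + ψ (n + 1) (2 * k + 1))) := by
    intro n k
    refine tendsto_nhds_unique ((hlim n k).comp (tendsto_add_atTop_nat 1)) ?_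
    have h1 := (((hlim (n + 1) (2 * k)).add (hlim (n + 1) (2 * k + 1))).const_mul q)
    refine ((tendsto_const_nhds (x := (1:ℝ))).min h1).congr fun h => ?_
    simp only [hφ, Function.comp]
    rw [Function.iterate_succ_apply', show n + 1 + h = n + (h + 1) by ring]
    rfl
  have hsuper : ∀ n k, ψ n k ≠ 1 →
      q * (ψ (n + 1) (2 * k) + ψ (n + 1) (2 * k + 1)) ≤ ψ n k := by
    intro n k hne
    have h1 := hrec n k
    rcases min_cases 1 (q * (ψ (n + 1) (2 * k) + ψ (n + 1) (2 * k + 1))) with h | h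
    · exact absurd (h1.trans h.1) hne
    · exact (h1.trans h.1).ge
  have hfull : ∀ x ∈ V, ∀ n, ∃ d, ψ (n + d) ⌊x * 2 ^ (n + d)⌋ = 1 := by
    intro x hx n
    obtain ⟨d, hd⟩ := exists_closedDyadicCell_subset hV hx n
    refine ⟨d, le_antisymm (hψ1 _ _) ?_⟩
    refine le_trans (le_of_eq ?_) (le_ciSup (hbdd _ _) 0)
    simp [hφ, cellIndicator, hd]
  have hψa : ∀ n k, a ≤ ψ n k := by
    intro n k
    have h1 := (hcont n k).trans (measure_le_of_supersolution hq0.le hψ0 hsuper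
      (hausdorffContent_dyadicCell_le ht0) hfull n k)
    rw [ENNReal.ofReal_le_ofReal_iff (mul_nonneg (by positivity) (hψ0 n k)), mul_comm] at h1
    exact le_of_mul_le_mul_left h1 (by positivity)
  have hgrow : ∀ m : ℕ, ∀ n k, min 1 ((2 * q) ^ m * a) ≤ ψ n k := by
    intro m
    induction m with
    | zero => intro n k; simpa using Or.inr (hψa n k)
    | succ m ih =>
      intro n k
      rw [hrec n k]
      refine le_min (min_le_left _ _) ?_
      have h1 := ih (n + 1) (2 * k)
      have h2 := ih (n + 1) (2 * k + 1)
      have h3 : 2 * q * min 1 ((2 * q) ^ m * a) ≤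
          q * (ψ (n + 1) (2 * k) + ψ (n + 1) (2 * k + 1)) := by nlinarith
      refine le_trans ?_ h3
      rw [mul_min_of_nonneg _ _ (by positivity), mul_one, ← mul_assoc, ← pow_succ']
      exact min_le_min hq1.le le_rfl
  have hone : ψ n k = 1 := by
    refine le_antisymm (hψ1 n k) ?_
    obtain ⟨m, hm⟩ := pow_unbounded_of_one_lt (1 / a) hq1
    rw [div_lt_iff₀ ha] at hm
    simpa [min_eq_left hm.le] using hgrow m n k
  exact (hlim n k).eventually (lt_mem_nhds (by rw [hone]; exact hr))

/-- The indicator function of a finite set of integers. -/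
def finsetWeight (S : Finset ℤ) (k : ℤ) : ℝ := if k ∈ S then 1 else 0

/-- One refinement step: inside a finite family of cells carrying weight above `1 / 2`, choose a
finite family of much smaller closed cells contained in `V` still carrying weight above `1 / 2`. -/
theorem exists_refinement {t : ℝ} (ht0 : 0 < t) (ht1 : t < 1) {V : Set ℝ}
    (hV : IsOpen V) {a : ℝ} (ha : 0 < a)
    (hcont : ∀ n k, ENNReal.ofReal (a * ((1 / 2) ^ t) ^ n) ≤
      hausdorffContent t (V ∩ dyadicCell n k))
    (N : ℕ) (S : Finset ℤ)
    (hS : 1 / 2 < (levelUp ((1 / 2) ^ t))^[N] (finsetWeight S) 0) :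
    ∃ (h : ℕ) (S' : Finset ℤ), 0 < h ∧
      (∀ k ∈ S', closedDyadicCell (N + h) k ⊆ V ∧ k / 2 ^ h ∈ S) ∧
      1 / 2 < (levelUp ((1 / 2) ^ t))^[N + h] (finsetWeight S') 0 := by
  set q : ℝ := (1 / 2) ^ t with hq
  have hq0 : 0 < q := by positivity
  set v := (levelUp q)^[N] (finsetWeight S) 0 with hv
  obtain ⟨r, hr, hr1⟩ : ∃ r, 1 / 2 / v < r ∧ r < 1 :=
    exists_between (by rw [div_lt_one (by linarith)]; exact hS)
  have hr0 : 0 < r := lt_trans (by positivity) hr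
  rw [div_lt_iff₀ (by linarith)] at hr
  have hev : ∀ᶠ h in atTop, ∀ k ∈ S, r < (levelUp q)^[h] (cellIndicator V (N + h)) k := by
    rw [Filter.eventually_all_finset]
    exact fun k _ => exists_iterate_cellIndicator_gt ht0 ht1 hV ha hcont N k hr1
  obtain ⟨h, hh, hpos⟩ := (hev.and (eventually_gt_atTop 0)).exists
  have hfin : {k : ℤ | closedDyadicCell (N + h) k ⊆ V ∧ k / 2 ^ h ∈ S}.Finite := by
    refine (S.finite_toSet.biUnion fun j _ =>
      Set.finite_Ico (j * 2 ^ h) ((j + 1) * 2 ^ h)).subset ?_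
    rintro k ⟨-, hk⟩
    refine mem_biUnion (x := k / 2 ^ h) hk ⟨?_, ?_⟩
    · exact Int.ediv_mul_le _ (by positivity)
    · exact Int.lt_ediv_add_one_mul_self _ (by positivity)
  refine ⟨h, hfin.toFinset, hpos, fun k hk => by simpa using hk, ?_⟩
  rw [Function.iterate_add_apply]
  have hge : r • finsetWeight S ≤ (levelUp q)^[h] (finsetWeight hfin.toFinset) := by
    intro k
    by_cases hk : k ∈ S
    · have heq : (levelUp q)^[h] (finsetWeight hfin.toFinset) k =
          (levelUp q)^[h] (cellIndicator V (N + h)) k := by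
        refine levelUp.iterate_congr h k fun j hj => ?_
        simp [finsetWeight, cellIndicator, hj, hk]
      rw [heq]
      simpa [finsetWeight, hk] using (hh k hk).le
    · have h0 : 0 ≤ finsetWeight hfin.toFinset := by
        intro j
        simp only [finsetWeight]
        split_ifs <;> simp
      simpa [finsetWeight, hk] using levelUp.iterate_nonneg hq0.le h0 h k
  have h1 := levelUp.smul_iterate_le hq0.le hr0.le hr1.le (finsetWeight S) N 0
  have h2 := levelUp.iterate_mono hq0.le N hge 0
  simp only [Pi.smul_apply, smul_eq_mul] at h1
  linarith

/-- A set of small diameter is contained in an open set meeting three consecutive dyadic cells. -/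
theorem exists_open_superset_cells {t : ℝ} (ht0 : 0 < t) (ht1 : t < 1) {U : Set ℝ} {w : ℝ}
    (hU : Metric.ediam U ^ t < ENNReal.ofReal w) (hw : w ≤ 1) :
    ∃ (O : Set ℝ) (n : ℕ) (k : ℤ), IsOpen O ∧ U ⊆ O ∧
      (∀ y ∈ O, ⌊y * 2 ^ n⌋ = k - 1 ∨ ⌊y * 2 ^ n⌋ = k ∨ ⌊y * 2 ^ n⌋ = k + 1) ∧
      ((1 / 2) ^ t) ^ n ≤ 2 * w := by
  have hw0 : 0 < w := by
    by_contra hcon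
    rw [ENNReal.ofReal_of_nonpos (not_lt.1 hcon)] at hU
    exact not_lt_zero hU
  set δ : ℝ := w ^ (1 / t) with hδ
  have hδ0 : 0 < δ := by positivity
  have hδ1 : δ ≤ 1 := Real.rpow_le_one hw0.le hw (by positivity)
  have hδt : δ ^ t = w := by
    rw [hδ, ← Real.rpow_mul hw0.le, one_div_mul_cancel ht0.ne', Real.rpow_one]
  have hdiam : Metric.ediam U < ENNReal.ofReal δ := by
    rw [← hδt, ← ENNReal.ofReal_rpow_of_pos hδ0] at hU
    exact (ENNReal.rpow_lt_rpow_iff ht0).1 hU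
  obtain ⟨x, hx⟩ : ∃ x, U ⊆ Metric.ball x δ := by
    rcases U.eq_empty_or_nonempty with rfl | ⟨x, hx⟩
    · exact ⟨0, empty_subset _⟩
    · refine ⟨x, fun y hy => ?_⟩
      have := (Metric.edist_le_ediam_of_mem hy hx).trans_lt hdiam
      rw [edist_dist, ENNReal.ofReal_lt_ofReal_iff hδ0] at this
      exact this
  obtain ⟨n, hn1, hn2⟩ := exists_nat_pow_near_of_lt_one hδ0 hδ1 (by norm_num : (0:ℝ) < 1 / 2)
    (by norm_num)
  refine ⟨Metric.ball x δ, n, ⌊x * 2 ^ n⌋, Metric.isOpen_ball, hx, ?_, ?_⟩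
  · intro y hy
    rw [Metric.mem_ball, Real.dist_eq] at hy
    have hlt : |y * 2 ^ n - x * 2 ^ n| < 1 := by
      rw [← sub_mul, abs_mul, abs_of_pos (by positivity : (0:ℝ) < 2 ^ n)]
      have h1 := hy.trans_le hn2
      rw [one_div, inv_pow, ← one_div, lt_div_iff₀ (by positivity)] at h1
      exact h1
    rw [abs_lt] at hlt
    have f1 := Int.floor_le (y * 2 ^ n)
    have f2 := Int.lt_floor_add_one (y * 2 ^ n)
    have f3 := Int.floor_le (x * 2 ^ n)
    have f4 := Int.lt_floor_add_one (x * 2 ^ n)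
    have g1 : ⌊y * 2 ^ n⌋ < ⌊x * 2 ^ n⌋ + 2 := by
      have : ((⌊y * 2 ^ n⌋ : ℤ) : ℝ) < ((⌊x * 2 ^ n⌋ + 2 : ℤ) : ℝ) := by push_cast; linarith
      exact_mod_cast this
    have g2 : ⌊x * 2 ^ n⌋ < ⌊y * 2 ^ n⌋ + 2 := by
      have : ((⌊x * 2 ^ n⌋ : ℤ) : ℝ) < ((⌊y * 2 ^ n⌋ + 2 : ℤ) : ℝ) := by push_cast; linarith
      exact_mod_cast this
    omega
  · rw [Real.rpow_pow_comm (by norm_num), ← hδt]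
    have h1 : ((1 / 2 : ℝ) ^ n) ≤ 2 * δ := by
      rw [pow_succ] at hn1
      linarith
    calc ((1 / 2 : ℝ) ^ n) ^ t ≤ (2 * δ) ^ t := Real.rpow_le_rpow (by positivity) h1 ht0.le
      _ = 2 ^ t * δ ^ t := Real.mul_rpow (by norm_num) hδ0.le
      _ ≤ 2 * δ ^ t := by
        gcongr
        calc (2:ℝ) ^ t ≤ 2 ^ (1:ℝ) := Real.rpow_le_rpow_of_exponent_le (by norm_num) ht1.le
          _ = 2 := Real.rpow_one 2

/-- The weight carried by a finite family of cells is at most the cost of any cover by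
larger cells. -/
theorem iterate_finsetWeight_le_sum {q : ℝ} (hq : 0 ≤ q) {N : ℕ} {S : Finset ℤ} {ι : Type*}
    (I : Finset ι) (n : ι → ℕ) (k : ι → ℤ) (hn : ∀ i ∈ I, n i ≤ N)
    (hcov : ∀ j ∈ S, ∃ i ∈ I, j / 2 ^ (N - n i) = k i - 1 ∨ j / 2 ^ (N - n i) = k i ∨
      j / 2 ^ (N - n i) = k i + 1) (r : ℤ) :
    (levelUp q)^[N] (finsetWeight S) r ≤ ∑ i ∈ I, 3 * q ^ n i := by
  set u : ι × ℤ → ℤ → ℝ := fun p j => if j / 2 ^ (N - n p.1) = k p.1 + p.2 then 1 else 0 with hu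
  have hu0 : ∀ p, 0 ≤ u p := by
    intro p j
    simp only [hu]
    split_ifs <;> simp
  have hle : finsetWeight S ≤ ∑ p ∈ I ×ˢ ({-1, 0, 1} : Finset ℤ), u p := by
    intro j
    rw [Finset.sum_apply]
    by_cases hj : j ∈ S
    · obtain ⟨i, hi, h⟩ := hcov j hj
      obtain ⟨e, he, h'⟩ : ∃ e ∈ ({-1, 0, 1} : Finset ℤ), j / 2 ^ (N - n i) = k i + e := by
        rcases h with h | h | h
        · exact ⟨-1, by simp, by omega⟩
        · exact ⟨0, by simp, by omega⟩
        · exact ⟨1, by simp, by omega⟩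
      refine le_trans (le_of_eq ?_) (Finset.single_le_sum (f := fun p => u p j)
        (fun p _ => hu0 p j) (Finset.mk_mem_product hi he))
      simp [finsetWeight, hj, hu, h']
    · simp only [finsetWeight, hj, if_false]
      exact Finset.sum_nonneg fun p _ => hu0 p j
  refine (levelUp.iterate_mono hq N hle r).trans ?_
  refine (levelUp.iterate_sum_le hq _ hu0 N r).trans ?_
  rw [Finset.sum_apply]
  refine (Finset.sum_le_sum (g := fun p => q ^ n p.1) fun p hp => ?_).trans (le_of_eq ?_)
  · exact levelUp.iterate_descendants_le_pow hq (hn p.1 (Finset.mem_product.1 hp).1) _ r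
  · rw [Finset.sum_product]
    refine Finset.sum_congr rfl fun i _ => ?_
    simp

/-- Countably many open sets with content bounded below proportionally in every dyadic cell
have an intersection of positive Hausdorff content. -/
theorem hausdorffContent_iInter_pos {t : ℝ} (ht0 : 0 < t) (ht1 : t < 1) {V : ℕ → Set ℝ}
    (hV : ∀ j, IsOpen (V j))
    (hcont : ∀ j, ∃ a : ℝ, 0 < a ∧ ∀ n k, ENNReal.ofReal (a * ((1 / 2) ^ t) ^ n) ≤
      hausdorffContent t (V j ∩ dyadicCell n k)) :
    ENNReal.ofReal (1 / 12) ≤ hausdorffContent t (⋂ j, V j) := by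
  set q : ℝ := (1 / 2) ^ t with hq
  have hq0 : 0 < q := by positivity
  choose a ha hcont using hcont
  let State := {p : ℕ × Finset ℤ // 1 / 2 < (levelUp q)^[p.1] (finsetWeight p.2) 0}
  have hstep : ∀ (j : ℕ) (p : State), ∃ p' : State, ∃ h, 0 < h ∧ p'.1.1 = p.1.1 + h ∧
      ∀ k ∈ p'.1.2, closedDyadicCell (p.1.1 + h) k ⊆ V j ∧ k / 2 ^ h ∈ p.1.2 := by
    rintro j ⟨⟨N, S⟩, hS⟩
    obtain ⟨h, S', hh, hS', hval⟩ := exists_refinement ht0 ht1 (hV j) (ha j) (hcont j) N S hS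
    exact ⟨⟨⟨N + h, S'⟩, hval⟩, h, hh, rfl, hS'⟩
  choose next hgt hpos hnext hmem using hstep
  let start : State := ⟨⟨0, {0}⟩, by norm_num [finsetWeight]⟩
  let st : ℕ → State := fun j => Nat.rec start next j
  have hst : ∀ j, st (j + 1) = next j (st j) := fun j => rfl
  set K : ℕ → Set ℝ := fun j => ⋃ k ∈ (st j).1.2, closedDyadicCell (st j).1.1 k with hK
  have hKcompact : ∀ j, IsCompact (K j) := fun j =>
    (st j).1.2.isCompact_biUnion fun k _ => isCompact_Icc
  have hKanti : Antitone K := by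
    refine antitone_nat_of_succ_le fun j => ?_
    simp only [hK]
    refine iUnion₂_subset fun k hk => ?_
    rw [hst] at hk ⊢
    rw [hnext]
    exact (closedDyadicCell_subset _ _ _).trans
      (subset_biUnion_of_mem (u := fun k => closedDyadicCell (st j).1.1 k) (hmem _ _ k hk).2)
  have hKV : ∀ j, K (j + 1) ⊆ V j := by
    intro j
    simp only [hK]
    refine iUnion₂_subset fun k hk => ?_
    rw [hst] at hk ⊢
    rw [hnext]
    exact (hmem _ _ k hk).1
  have hN : StrictMono fun j => (st j).1.1 := by
    refine strictMono_nat_of_lt_succ fun j => ?_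
    rw [hst, hnext]
    exact Nat.lt_add_of_pos_right (hpos _ _)
  refine le_trans ?_ (measure_mono (subset_iInter fun j => (iInter_subset K (j + 1)).trans (hKV j)))
  by_contra! hlt
  rw [hausdorffContent_eq ht0] at hlt
  simp only [iInf_lt_iff] at hlt
  obtain ⟨U, hUK, hUsum⟩ := hlt
  obtain ⟨ε, hε0, hεsum⟩ := ENNReal.exists_pos_sum_of_countable'
    (tsub_pos_of_lt hUsum).ne' ℕ
  have htot : ∑' i, (Metric.ediam (U i) ^ t + ε i) < ENNReal.ofReal (1 / 12) := by
    rw [ENNReal.tsum_add]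
    rw [lt_tsub_iff_left] at hεsum
    exact hεsum
  have hfin : ∀ i, Metric.ediam (U i) ^ t + ε i < ENNReal.ofReal (1 / 12) := fun i =>
    (ENNReal.le_tsum i).trans_lt htot
  set w : ℕ → ℝ := fun i => (Metric.ediam (U i) ^ t + ε i).toReal with hw
  have hwof : ∀ i, ENNReal.ofReal (w i) = Metric.ediam (U i) ^ t + ε i := fun i =>
    ENNReal.ofReal_toReal (hfin i).ne_top
  have hw1 : ∀ i, w i ≤ 1 := by
    intro i
    have h1 := (hfin i).le
    rw [← hwof, ENNReal.ofReal_le_ofReal_iff (by norm_num)] at h1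
    linarith
  have hUw : ∀ i, Metric.ediam (U i) ^ t < ENNReal.ofReal (w i) := by
    intro i
    rw [hwof]
    have hne : Metric.ediam (U i) ^ t ≠ ⊤ := (le_self_add.trans_lt (hfin i)).ne_top
    exact ENNReal.lt_add_right hne (hε0 i).ne'
  choose O n k hOopen hUO hOfloor hcost using fun i =>
    exists_open_superset_cells ht0 ht1 (hUw i) (hw1 i)
  have hKO : ⋂ j, K j ⊆ ⋃ i, O i := hUK.trans (iUnion_mono hUO)
  obtain ⟨I, hI⟩ := ((hKcompact 0).of_isClosed_subset
    (isClosed_iInter fun j => (hKcompact j).isClosed) (iInter_subset K 0)).elim_finite_subcover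
    O hOopen hKO
  have hOI : IsOpen (⋃ i ∈ I, O i) := isOpen_biUnion fun i _ => hOopen i
  obtain ⟨j₀, hj₀⟩ := exists_subset_nhds_of_isCompact' (directed_of_isDirected_le
    (fun i j h => hKanti h)) hKcompact (fun j => (hKcompact j).isClosed)
    (fun x hx => hOI.mem_nhds (hI hx))
  obtain ⟨j, hj, hjn⟩ : ∃ j, j₀ ≤ j ∧ ∀ i ∈ I, n i ≤ (st j).1.1 := by
    refine ⟨max j₀ (I.sup n), le_max_left _ _, fun i hi => ?_⟩
    exact (Finset.le_sup hi).trans ((le_max_right j₀ _).trans hN.le_apply)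
  have hval := iterate_finsetWeight_le_sum hq0.le (S := (st j).1.2) I n k hjn (by
    intro l hl
    have hmemK : (l : ℝ) / 2 ^ (st j).1.1 ∈ K j := by
      refine mem_biUnion hl ⟨le_rfl, ?_⟩
      gcongr
      linarith
    obtain ⟨i, hi, hO⟩ := mem_iUnion₂.1 (hj₀ (hKanti hj hmemK))
    refine ⟨i, hi, ?_⟩
    have h1 := floor_mul_two_pow_add ((l : ℝ) / 2 ^ (st j).1.1) (n i) ((st j).1.1 - n i)
    rw [Nat.add_sub_cancel' (hjn i hi), div_mul_cancel₀ _ (by positivity), Int.floor_intCast] at h1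
    rw [← h1]
    exact hOfloor i _ hO) 0
  have hgt := (st j).2
  have hsum : ∑ i ∈ I, w i ≤ 1 / 12 := by
    rw [← ENNReal.ofReal_le_ofReal_iff (by norm_num),
      ENNReal.ofReal_sum_of_nonneg (f := w) fun i _ => ENNReal.toReal_nonneg,
      Finset.sum_congr rfl fun i _ => hwof i]
    exact (ENNReal.sum_le_tsum I).trans htot.le
  have hsum2 : ∑ i ∈ I, 3 * q ^ n i ≤ 6 * ∑ i ∈ I, w i := by
    rw [Finset.mul_sum]
    exact Finset.sum_le_sum fun i _ => by linarith [hcost i]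
  linarith

theorem le_dimH_of_hausdorffContent_pos {t : ℝ} (ht0 : 0 < t) {A : Set ℝ}
    (h : 0 < hausdorffContent t A) : ENNReal.ofReal t ≤ dimH A := by
  refine le_dimH_of_hausdorffMeasure_ne_zero (d := t.toNNReal) ?_
  rw [Real.coe_toNNReal _ ht0.le]
  exact (h.trans_le (hausdorffContent_le_hausdorffMeasure ht0 A)).ne'

namespace ExpandingFullShift

theorem branch_subset (E : ExpandingFullShift) (i : Fin E.g) : E.branch i ⊆ Ico 0 1 :=
  E.branch_cover ▸ subset_iUnion E.branch i

theorem cylinder_nil (E : ExpandingFullShift) : E.cylinder [] = Ico 0 1 := by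
  ext x
  simp [cylinder]

theorem cylinder_cons (E : ExpandingFullShift) (i : Fin E.g) (w : List (Fin E.g)) :
    E.cylinder (i :: w) = {x ∈ E.branch i | E.f x ∈ E.cylinder w} := by
  ext x
  constructor
  · rintro ⟨-, h⟩
    have hx : x ∈ E.branch i := h 0 (by simp)
    refine ⟨hx, E.f_onto i ▸ mem_image_of_mem _ hx, fun k hk => ?_⟩
    exact h (k + 1) (by simpa using hk)
  · rintro ⟨hx, -, h⟩
    refine ⟨E.branch_subset i hx, fun k hk => ?_⟩
    cases k with
    | zero => exact hx
    | succ k => exact h k (by simpa using hk)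

theorem mem_cylinder_concat (E : ExpandingFullShift) (w : List (Fin E.g)) (i : Fin E.g) :
    ∀ x, x ∈ E.cylinder (w ++ [i]) ↔ x ∈ E.cylinder w ∧ E.f^[w.length] x ∈ E.branch i := by
  induction w with
  | nil =>
    intro x
    rw [List.nil_append, cylinder_cons, cylinder_nil]
    refine ⟨fun h => ⟨E.branch_subset i h.1, h.1⟩, fun h => ⟨h.2, ?_⟩⟩
    rw [← E.f_onto i]
    exact mem_image_of_mem _ h.2
  | cons j w ih =>
    intro x
    simp only [List.cons_append, cylinder_cons, mem_ofPred_eq, ih, List.length_cons,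
      Function.iterate_succ_apply]
    tauto

theorem ordConnected_cylinder (E : ExpandingFullShift) (w : List (Fin E.g)) :
    (E.cylinder w).OrdConnected := by
  induction w with
  | nil => rw [cylinder_nil]; exact ordConnected_Ico
  | cons i w ih =>
    rw [cylinder_cons]
    refine ⟨fun x hx z hz y hy => ?_⟩
    obtain ⟨a, b, -, hab⟩ := E.branch_Ico i
    have hyb : y ∈ E.branch i := by
      have hx' := hx.1
      have hz' := hz.1
      rw [hab] at hx' hz' ⊢
      exact ordConnected_Ico.out hx' hz' hy
    refine ⟨hyb, ?_⟩
    rcases E.f_mono i with hm | hm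
    · exact ih.out hx.2 hz.2 ⟨hm.monotoneOn hx.1 hyb hy.1, hm.monotoneOn hyb hz.1 hy.2⟩
    · exact ih.out hz.2 hx.2 ⟨hm.antitoneOn hyb hz.1 hy.2, hm.antitoneOn hx.1 hyb hy.1⟩

/-- The length of a cylinder. -/
def len (E : ExpandingFullShift) (w : List (Fin E.g)) : ℝ := (volume (E.cylinder w)).toReal

theorem len_nonneg (E : ExpandingFullShift) (w : List (Fin E.g)) : 0 ≤ E.len w :=
  ENNReal.toReal_nonneg

theorem volume_cylinder_ne_top (E : ExpandingFullShift) (w : List (Fin E.g)) :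
    volume (E.cylinder w) ≠ ⊤ := by
  have h : E.cylinder w ⊆ Ico 0 1 := fun x hx => hx.1
  exact (measure_mono h).trans_lt (by simp) |>.ne

theorem len_nil (E : ExpandingFullShift) : E.len [] = 1 := by
  simp [len, cylinder_nil]

theorem len_single_pos (E : ExpandingFullShift) (i : Fin E.g) : 0 < E.len [i] := by
  have h : E.cylinder [i] = E.branch i := by
    ext x
    rw [cylinder_cons, cylinder_nil, mem_ofPred_eq]
    refine ⟨fun h => h.1, fun h => ⟨h, ?_⟩⟩
    rw [← E.f_onto i]
    exact mem_image_of_mem _ h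
  obtain ⟨a, b, hlt, hab⟩ := E.branch_Ico i
  rw [len, h, hab, Real.volume_Ico, ENNReal.toReal_ofReal (by linarith)]
  linarith

theorem len_mul_le (E : ExpandingFullShift) {K : ℝ} (hK : 1 ≤ K) (hbd : E.HasBoundedDistortion K)
    (u v : List (Fin E.g)) : E.len u * E.len v ≤ K * E.len (u ++ v) := by
  have h := ENNReal.toReal_mono
    (ENNReal.mul_ne_top ENNReal.ofReal_ne_top (E.volume_cylinder_ne_top _)) (hbd u v).2
  rwa [ENNReal.toReal_mul, ENNReal.toReal_mul, ENNReal.toReal_ofReal (by linarith)] at h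

theorem len_concat_add_le (E : ExpandingFullShift) (u : List (Fin E.g)) {i j : Fin E.g}
    (hij : i ≠ j) : E.len (u ++ [i]) + E.len (u ++ [j]) ≤ E.len u := by
  have hdisj : Disjoint (E.cylinder (u ++ [i])) (E.cylinder (u ++ [j])) := by
    rw [Set.disjoint_left]
    intro x hi hj
    rw [mem_cylinder_concat] at hi hj
    exact (E.branch_disjoint i j hij).le_bot ⟨hi.2, hj.2⟩
  have hsub : E.cylinder (u ++ [i]) ∪ E.cylinder (u ++ [j]) ⊆ E.cylinder u := by
    rintro x (h | h) <;> exact ((E.mem_cylinder_concat _ _ _).1 h).1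
  have h := measure_mono (μ := volume) hsub
  rw [measure_union hdisj (E.ordConnected_cylinder _).measurableSet] at h
  have hle := ENNReal.toReal_mono (E.volume_cylinder_ne_top u) h
  rwa [ENNReal.toReal_add (E.volume_cylinder_ne_top _) (E.volume_cylinder_ne_top _)] at hle

/-- Bounded distortion makes all ratios between a cylinder and its children uniformly bounded
away from `0` and `1`. -/
theorem exists_ratio_bound (E : ExpandingFullShift) {K : ℝ} (hK : 1 ≤ K)
    (hbd : E.HasBoundedDistortion K) :
    ∃ η : ℝ, 0 < η ∧ η < 1 ∧ ∀ u i, η * E.len u ≤ E.len (u ++ [i]) ∧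
      E.len (u ++ [i]) ≤ (1 - η) * E.len u := by
  have : Nonempty (Fin E.g) := ⟨E.zeroSym⟩
  have : Nontrivial (Fin E.g) := Fin.nontrivial_iff_two_le.2 E.one_lt_g
  obtain ⟨i₀, hi₀⟩ := Finite.exists_min fun i => E.len [i]
  have hpos := E.len_single_pos i₀
  have hlow : ∀ u i, E.len [i₀] / K * E.len u ≤ E.len (u ++ [i]) := by
    intro u i
    rw [div_mul_eq_mul_div, div_le_iff₀ (by linarith)]
    have h1 := E.len_mul_le hK hbd u [i]
    have h2 : E.len [i₀] * E.len u ≤ E.len [i] * E.len u :=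
      mul_le_mul_of_nonneg_right (hi₀ i) ENNReal.toReal_nonneg
    linarith
  have hup : ∀ u i, E.len (u ++ [i]) ≤ (1 - E.len [i₀] / K) * E.len u := by
    intro u i
    obtain ⟨j, hj⟩ := exists_ne i
    have h1 := E.len_concat_add_le u hj.symm
    have h2 := hlow u j
    linarith
  refine ⟨E.len [i₀] / K, by positivity, ?_, fun u i => ⟨hlow u i, hup u i⟩⟩
  have h := hup [] i₀
  rw [len_nil, List.nil_append] at h
  linarith

/-- The symbol of the branch containing `x`. -/
def symbol (E : ExpandingFullShift) (x : ℝ) : Fin E.g :=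
  if h : ∃ i, x ∈ E.branch i then h.choose else E.zeroSym

theorem symbol_eq_iff (E : ExpandingFullShift) {x : ℝ} (hx : x ∈ Ico (0:ℝ) 1) (i : Fin E.g) :
    E.symbol x = i ↔ x ∈ E.branch i := by
  have h : ∃ i, x ∈ E.branch i := by
    rw [← E.branch_cover] at hx
    exact mem_iUnion.1 hx
  have hs : x ∈ E.branch (E.symbol x) := by
    rw [symbol, dif_pos h]
    exact h.choose_spec
  refine ⟨fun hi => hi ▸ hs, fun hi => ?_⟩
  by_contra hne
  exact (E.branch_disjoint _ _ hne).le_bot ⟨hs, hi⟩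

theorem iterate_mem_Ico (E : ExpandingFullShift) {x : ℝ} (hx : x ∈ Ico (0:ℝ) 1) (n : ℕ) :
    E.f^[n] x ∈ Ico (0:ℝ) 1 := by
  induction n with
  | zero => exact hx
  | succ n ih =>
    rw [Function.iterate_succ_apply']
    have h := (E.symbol_eq_iff ih _).1 rfl
    exact E.f_onto _ ▸ mem_image_of_mem _ h

/-- The first `n` symbols of the fractional part of `x`. -/
def word (E : ExpandingFullShift) (n : ℕ) (x : ℝ) : List (Fin E.g) :=
  (List.range n).map fun i => E.symbol (E.f^[i] (Int.fract x))

theorem word_succ (E : ExpandingFullShift) (n : ℕ) (x : ℝ) :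
    E.word (n + 1) x = E.word n x ++ [E.symbol (E.f^[n] (Int.fract x))] := by
  simp [word, List.range_succ]

/-- The cylinder of generation `n` of the periodic extension which contains `x`. -/
def pointCylinder (E : ExpandingFullShift) (n : ℕ) (x : ℝ) : Set ℝ :=
  {y | ⌊y⌋ = ⌊x⌋ ∧ E.word n y = E.word n x}

theorem self_mem_pointCylinder (E : ExpandingFullShift) (n : ℕ) (x : ℝ) :
    x ∈ E.pointCylinder n x := ⟨rfl, rfl⟩

theorem pointCylinder_eq_of_mem (E : ExpandingFullShift) {n : ℕ} {x y : ℝ}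
    (h : y ∈ E.pointCylinder n x) : E.pointCylinder n y = E.pointCylinder n x := by
  ext z
  simp only [pointCylinder, mem_ofPred_eq, h.1, h.2]

theorem word_eq_of_le (E : ExpandingFullShift) {m n : ℕ} (hmn : m ≤ n) {x y : ℝ}
    (h : E.word n y = E.word n x) : E.word m y = E.word m x := by
  have key : ∀ z, E.word m z = (E.word n z).take m := by
    intro z
    rw [word, word, ← List.map_take, List.take_range, min_eq_left hmn]
  rw [key, key, h]

theorem fract_mem_cylinder_word_iff (E : ExpandingFullShift) (n : ℕ) (x y : ℝ) :
    Int.fract y ∈ E.cylinder (E.word n x) ↔ E.word n y = E.word n x := by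
  have hy : Int.fract y ∈ Ico (0:ℝ) 1 := ⟨Int.fract_nonneg y, Int.fract_lt_one y⟩
  induction n with
  | zero =>
    simp only [word, List.range_zero, List.map_nil, iff_true, cylinder_nil]
    exact hy
  | succ n ih =>
    have hlen : (E.word n x).length = n := by simp [word]
    rw [word_succ, word_succ, mem_cylinder_concat, propext ih, hlen,
      ← E.symbol_eq_iff (E.iterate_mem_Ico hy n)]
    refine ⟨fun h => by rw [h.1, h.2], fun h => ?_⟩
    have h' := List.append_inj' h rfl
    exact ⟨h'.1, by simpa using h'.2⟩

theorem pointCylinder_eq_image (E : ExpandingFullShift) (n : ℕ) (x : ℝ) :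
    E.pointCylinder n x = (fun y => y + (⌊x⌋ : ℝ)) '' E.cylinder (E.word n x) := by
  ext y
  constructor
  · rintro ⟨h1, h2⟩
    refine ⟨Int.fract y, (E.fract_mem_cylinder_word_iff n x y).2 h2, ?_⟩
    dsimp only
    rw [← h1, Int.fract_add_floor]
  · rintro ⟨z, hz, rfl⟩
    have hz1 : z ∈ Ico (0:ℝ) 1 := hz.1
    have hf : Int.fract (z + (⌊x⌋ : ℝ)) = z := by
      rw [Int.fract_add_intCast, Int.fract_eq_self.2 hz1]
    refine ⟨?_, (E.fract_mem_cylinder_word_iff n x _).1 (by rwa [hf])⟩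
    rw [Int.floor_add_intCast, Int.floor_eq_zero_iff.2 hz1, zero_add]

theorem isCylinderZ_pointCylinder (E : ExpandingFullShift) (n : ℕ) (x : ℝ) :
    E.IsCylinderZ (E.pointCylinder n x) :=
  ⟨E.word n x, ⌊x⌋, E.pointCylinder_eq_image n x⟩

theorem volume_pointCylinder (E : ExpandingFullShift) (n : ℕ) (x : ℝ) :
    volume (E.pointCylinder n x) = ENNReal.ofReal (E.len (E.word n x)) := by
  rw [pointCylinder_eq_image, image_add_right, measure_preimage_add_right, len,
    ENNReal.ofReal_toReal (E.volume_cylinder_ne_top _)]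

theorem ordConnected_pointCylinder (E : ExpandingFullShift) (n : ℕ) (x : ℝ) :
    (E.pointCylinder n x).OrdConnected := by
  rw [pointCylinder_eq_image, image_add_right]
  exact (E.ordConnected_cylinder _).preimage_mono fun a b h => by gcongr

theorem abs_sub_le_of_mem_pointCylinder (E : ExpandingFullShift) {n : ℕ} {x y z : ℝ}
    (hy : y ∈ E.pointCylinder n x) (hz : z ∈ E.pointCylinder n x) :
    |y - z| ≤ E.len (E.word n x) := by
  have h := measure_mono (μ := volume) ((E.ordConnected_pointCylinder n x).uIcc_subset hy hz)
  rw [volume_pointCylinder, Real.volume_interval, ENNReal.ofReal_le_ofReal_iff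
    (E.len_nonneg _)] at h
  rwa [abs_sub_comm]

/-- Generation `n` is the first one where the cylinder around `x` has length at most `d`. -/
def IsStop (E : ExpandingFullShift) (d : ℝ) (n : ℕ) (x : ℝ) : Prop :=
  E.len (E.word n x) ≤ d ∧ ∀ m < n, d < E.len (E.word m x)

theorem IsStop.of_mem {E : ExpandingFullShift} {d : ℝ} {n : ℕ} {x y : ℝ} (h : E.IsStop d n x)
    (hy : y ∈ E.pointCylinder n x) : E.IsStop d n y := by
  refine ⟨hy.2 ▸ h.1, fun m hm => ?_⟩
  rw [E.word_eq_of_le hm.le hy.2]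
  exact h.2 m hm

theorem IsStop.unique {E : ExpandingFullShift} {d : ℝ} {m n : ℕ} {x : ℝ} (hm : E.IsStop d m x)
    (hn : E.IsStop d n x) : m = n := by
  rcases lt_trichotomy m n with h | h | h
  · exact absurd hm.1 (hn.2 m h).not_ge
  · exact h
  · exact absurd hn.1 (hm.2 n h).not_ge

theorem exists_isStop (E : ExpandingFullShift) {η : ℝ} (hη0 : 0 < η) (hη1 : η < 1)
    (hη : ∀ u i, η * E.len u ≤ E.len (u ++ [i]) ∧ E.len (u ++ [i]) ≤ (1 - η) * E.len u)
    {d : ℝ} (hd0 : 0 < d) (hd1 : d ≤ 1) (x : ℝ) :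
    ∃ n, E.IsStop d n x ∧ η * d ≤ E.len (E.word n x) := by
  have hdecay : ∀ n, E.len (E.word n x) ≤ (1 - η) ^ n := by
    intro n
    induction n with
    | zero => simp [word, len_nil]
    | succ n ih =>
      rw [word_succ, pow_succ']
      exact (hη _ _).2.trans (mul_le_mul_of_nonneg_left ih (by linarith))
  have hex : ∃ n, E.len (E.word n x) ≤ d := by
    obtain ⟨n, hn⟩ := exists_pow_lt_of_lt_one hd0 (by linarith : 1 - η < 1)
    exact ⟨n, (hdecay n).trans hn.le⟩
  refine ⟨Nat.find hex, ⟨Nat.find_spec hex, fun m hm => not_le.1 (Nat.find_min hex hm)⟩, ?_⟩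
  rcases h : Nat.find hex with _ | n
  · simp only [word, List.range_zero, List.map_nil, len_nil]
    nlinarith
  · rw [word_succ]
    have h1 := not_le.1 (Nat.find_min hex (m := n) (by omega))
    exact (mul_le_mul_of_nonneg_left h1.le hη0.le).trans (hη _ _).1

/-- The outer measure generated by covers with cylinders or empty sets. -/
def cylOuterMeasure (E : ExpandingFullShift) (s : ℝ) : OuterMeasure ℝ :=
  OuterMeasure.ofFunction
    (fun A : Set ℝ => if A = ∅ then 0 else if E.IsCylinderZ A then volume A ^ s else ⊤) (by simp)

theorem cylOuterMeasure_le_of_isCylinderZ (E : ExpandingFullShift) (s : ℝ) {C : Set ℝ}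
    (hC : E.IsCylinderZ C) : E.cylOuterMeasure s C ≤ volume C ^ s := by
  refine (OuterMeasure.ofFunction_le C).trans ?_
  rw [if_pos hC]
  split_ifs
  · exact zero_le
  · exact le_rfl

theorem exists_ofReal_rpow_le {s : ℝ} (hs : 0 < s) {ε : ℝ≥0∞} (hε : 0 < ε) :
    ∃ d : ℝ, 0 < d ∧ d ≤ 1 ∧ ENNReal.ofReal d ^ s ≤ ε := by
  have hne : min ε 1 ≠ ⊤ := ((min_le_right _ _).trans_lt ENNReal.one_lt_top).ne
  have hpos : 0 < (min ε 1).toReal := ENNReal.toReal_pos (lt_min hε one_pos).ne' hne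
  refine ⟨(min ε 1).toReal ^ (1 / s), by positivity, Real.rpow_le_one hpos.le ?_ (by positivity),
    ?_⟩
  · exact ENNReal.toReal_mono ENNReal.one_ne_top (min_le_right _ _)
  · rw [ENNReal.ofReal_rpow_of_pos (by positivity), ← Real.rpow_mul hpos.le,
      one_div_mul_cancel hs.ne', Real.rpow_one, ENNReal.ofReal_toReal hne]
    exact min_le_left _ _

theorem cylMeasureZ_le_cylOuterMeasure (E : ExpandingFullShift) {K : ℝ} (hK : 1 ≤ K)
    (hbd : E.HasBoundedDistortion K) {s : ℝ} (hs : 0 < s) (A : Set ℝ) :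
    E.cylMeasureZ s A ≤ E.cylOuterMeasure s A := by
  obtain ⟨η, hη0, hη1, hη⟩ := E.exists_ratio_bound hK hbd
  rw [cylOuterMeasure, OuterMeasure.ofFunction_apply]
  refine le_iInf₂ fun U hU => ?_
  by_cases hcyl : ∀ i, U i = ∅ ∨ E.IsCylinderZ (U i)
  swap
  · push Not at hcyl
    obtain ⟨i, h1, h2⟩ := hcyl
    refine le_trans le_top (le_trans (le_of_eq ?_) (ENNReal.le_tsum i))
    rw [if_neg h1.ne_empty, if_neg h2]
  refine ENNReal.le_of_forall_pos_le_add fun ε hε _ => ?_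
  obtain ⟨δ, hδ0, hδ⟩ := ENNReal.exists_pos_sum_of_countable' (ENNReal.coe_pos.2 hε).ne' ℕ
  have hsmall : ∀ i, ∃ C, E.IsCylinderZ C ∧ volume C ^ s ≤ δ i := by
    intro i
    obtain ⟨d, hd0, hd1, hd⟩ := exists_ofReal_rpow_le hs (hδ0 i)
    obtain ⟨n, hn, -⟩ := E.exists_isStop hη0 hη1 hη hd0 hd1 0
    refine ⟨E.pointCylinder n 0, E.isCylinderZ_pointCylinder n 0, le_trans ?_ hd⟩
    rw [volume_pointCylinder]
    exact ENNReal.rpow_le_rpow (ENNReal.ofReal_le_ofReal hn.1) hs.le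
  choose C hC hCδ using hsmall
  refine (iInf₂_le (fun i => if U i = ∅ then C i else U i) fun i => ?_).trans ?_
  · dsimp only
    split_ifs with h
    · exact hC i
    · exact (hcyl i).resolve_left h
  refine (iInf_le _ (hU.trans (iUnion_mono fun i => ?_))).trans ?_
  · split_ifs with h
    · simp [h]
    · exact le_rfl
  · refine le_trans ?_ (add_le_add_right hδ.le _)
    rw [← ENNReal.tsum_add]
    refine ENNReal.tsum_le_tsum fun i => ?_
    by_cases h : U i = ∅
    · simp [h, hCδ i]
    · simp [h, (hcyl i).resolve_left h]

/-- Sets of diameter at most `d` are covered by boundedly many cylinders of length at most `d`. -/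
theorem exists_cylOuterMeasure_le (E : ExpandingFullShift) {K : ℝ} (hK : 1 ≤ K)
    (hbd : E.HasBoundedDistortion K) :
    ∃ M : ℕ, 0 < M ∧ ∀ (s : ℝ), 0 < s → ∀ (d : ℝ), 0 < d → d ≤ 1 → ∀ U : Set ℝ,
      Metric.ediam U ≤ ENNReal.ofReal d →
      E.cylOuterMeasure s U ≤ M * ENNReal.ofReal d ^ s := by
  obtain ⟨η, hη0, hη1, hη⟩ := E.exists_ratio_bound hK hbd
  refine ⟨⌈6 / η⌉₊ + 2, by omega, fun s hs d hd0 hd1 U hU => ?_⟩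
  rcases U.eq_empty_or_nonempty with rfl | ⟨x, hx⟩
  · simp
  choose n hn hnlen using E.exists_isStop hη0 hη1 hη hd0 hd1
  set p : ℕ → ℝ := fun j => x - 2 * d + j * (η * d / 2) with hp
  have hstep : 0 < η * d / 2 := by positivity
  have hsub : U ⊆ ⋃ j ∈ Finset.range (⌈6 / η⌉₊ + 2), E.pointCylinder (n (p j)) (p j) := by
    intro y hy
    have hxy : |y - x| ≤ d := by
      have h := (Metric.edist_le_ediam_of_mem hy hx).trans hU
      rwa [edist_dist, ENNReal.ofReal_le_ofReal_iff hd0.le, Real.dist_eq] at h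
    rw [abs_le] at hxy
    set j := ⌊(y - (x - 2 * d)) / (η * d / 2)⌋₊ with hj
    have hj1 : p j ≤ y := by
      have h := Nat.floor_le (div_nonneg (by linarith : 0 ≤ y - (x - 2 * d)) hstep.le)
      rw [← hj, le_div_iff₀ hstep] at h
      simp only [hp]
      linarith
    have hj2 : y < p (j + 1) := by
      have h := Nat.lt_floor_add_one ((y - (x - 2 * d)) / (η * d / 2))
      rw [← hj, div_lt_iff₀ hstep] at h
      simp only [hp]
      push_cast
      linarith
    have hjM : j ≤ ⌈6 / η⌉₊ := by
      refine (Nat.floor_le_ceil _).trans (Nat.ceil_mono ?_)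
      rw [div_le_div_iff₀ hstep hη0]
      nlinarith
    have hmem : p j ∈ E.pointCylinder (n y) y ∨ p (j + 1) ∈ E.pointCylinder (n y) y := by
      by_contra! hcon
      have hoc := E.ordConnected_pointCylinder (n y) y
      have hys := E.self_mem_pointCylinder (n y) y
      have hIoo : E.pointCylinder (n y) y ⊆ Ioo (p j) (p (j + 1)) := by
        intro z hz
        constructor
        · by_contra! hle
          exact hcon.1 (hoc.out hz hys ⟨hle, hj1⟩)
        · by_contra! hle
          exact hcon.2 (hoc.out hys hz ⟨hj2.le, hle⟩)
      have h := measure_mono (μ := volume) hIoo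
      have hdiff : p (j + 1) - p j = η * d / 2 := by
        simp only [hp]
        push_cast
        ring
      rw [volume_pointCylinder, Real.volume_Ioo, hdiff,
        ENNReal.ofReal_le_ofReal_iff hstep.le] at h
      have := hnlen y
      linarith
    have key : ∀ l, l ≤ ⌈6 / η⌉₊ + 1 → p l ∈ E.pointCylinder (n y) y →
        y ∈ ⋃ j ∈ Finset.range (⌈6 / η⌉₊ + 2), E.pointCylinder (n (p j)) (p j) := by
      intro l hl hpl
      refine mem_biUnion (x := l) (Finset.mem_coe.2 (Finset.mem_range.2 (by omega))) ?_
      rw [(hn (p l)).unique ((hn y).of_mem hpl), E.pointCylinder_eq_of_mem hpl]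
      exact E.self_mem_pointCylinder _ _
    rcases hmem with h | h
    · exact key j (by omega) h
    · exact key (j + 1) (by omega) h
  refine (measure_mono hsub).trans ((measure_biUnion_finset_le _ _).trans ?_)
  refine (Finset.sum_le_card_nsmul _ _ (ENNReal.ofReal d ^ s) fun j _ => ?_).trans ?_
  · refine (E.cylOuterMeasure_le_of_isCylinderZ s (E.isCylinderZ_pointCylinder _ _)).trans ?_
    rw [volume_pointCylinder]
    exact ENNReal.rpow_le_rpow (ENNReal.ofReal_le_ofReal (hn _).1) hs.le
  · rw [Finset.card_range, nsmul_eq_mul]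

theorem exists_cylOuterMeasure_le_ediam (E : ExpandingFullShift) {K : ℝ} (hK : 1 ≤ K)
    (hbd : E.HasBoundedDistortion K) {s : ℝ} (hs : 0 < s) :
    ∃ M : ℕ, 0 < M ∧ ∀ U : Set ℝ, Metric.ediam U ≤ 1 →
      E.cylOuterMeasure s U ≤ M * Metric.ediam U ^ s := by
  obtain ⟨M, hM, h⟩ := E.exists_cylOuterMeasure_le hK hbd
  refine ⟨M, hM, fun U hU => ?_⟩
  have hne : Metric.ediam U ≠ ⊤ := (hU.trans_lt ENNReal.one_lt_top).ne
  rcases eq_or_ne (Metric.ediam U) 0 with h0 | h0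
  · refine ENNReal.le_of_forall_pos_le_add fun ε hε _ => ?_
    have hM0 : (M : ℝ≥0∞) ≠ 0 := by exact_mod_cast hM.ne'
    obtain ⟨d, hd0, hd1, hd⟩ := exists_ofReal_rpow_le hs
      (ENNReal.div_pos (ENNReal.coe_pos.2 hε).ne' (ENNReal.natCast_ne_top M))
    refine (h s hs d hd0 hd1 U (by simp [h0])).trans ?_
    refine le_trans ?_ le_add_self
    refine (mul_le_mul_right hd _).trans (le_of_eq ?_)
    exact ENNReal.mul_div_cancel hM0 (ENNReal.natCast_ne_top M)
  · have h1 := h s hs (Metric.ediam U).toReal (ENNReal.toReal_pos h0 hne)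
      (ENNReal.toReal_mono ENNReal.one_ne_top hU) U (ENNReal.ofReal_toReal hne).ge
    rwa [ENNReal.ofReal_toReal hne] at h1

end ExpandingFullShift

theorem le_mul_hausdorffContent {t : ℝ} (ht : 0 < t) {κ x : ℝ≥0∞} (hκ0 : κ ≠ 0) (hκ : κ ≠ ⊤)
    {B : Set ℝ} (h : ∀ U : ℕ → Set ℝ, B ⊆ ⋃ i, U i → x ≤ κ * ∑' i, Metric.ediam (U i) ^ t) :
    x ≤ κ * hausdorffContent t B := by
  refine (ENNReal.div_le_iff_le_mul (Or.inl hκ0) (Or.inl hκ)).1 ?_ |>.trans_eq (mul_comm _ _)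
  rw [hausdorffContent_eq ht]
  refine le_iInf₂ fun U hU => ?_
  rw [ENNReal.div_le_iff_le_mul (Or.inl hκ0) (Or.inl hκ), mul_comm]
  exact h U hU

/-- Contents of sets of small diameter with different exponents. -/
theorem hausdorffContent_le_rpow_mul {t s : ℝ} (ht : 0 < t) (hts : t ≤ s) {v : ℝ} (hv : 0 < v)
    {A : Set ℝ} (hA : Metric.ediam A ≤ ENNReal.ofReal v) :
    hausdorffContent s A ≤ ENNReal.ofReal v ^ (s - t) * hausdorffContent t A := by
  have hv0 : 0 < ENNReal.ofReal v := ENNReal.ofReal_pos.2 hv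
  refine le_mul_hausdorffContent ht (ENNReal.rpow_pos hv0 ENNReal.ofReal_ne_top).ne'
    (ENNReal.rpow_ne_top_of_nonneg (by linarith) ENNReal.ofReal_ne_top) fun U hU => ?_
  rw [hausdorffContent_eq (ht.trans_le hts)]
  refine (iInf₂_le (fun i => A ∩ U i) (by
    rw [← inter_iUnion]; exact subset_inter subset_rfl hU)).trans ?_
  rw [← ENNReal.tsum_mul_left]
  refine ENNReal.tsum_le_tsum fun i => ?_
  have hs : s = (s - t) + t := by ring
  nth_rewrite 1 [hs]
  rw [ENNReal.rpow_add_of_nonneg _ _ (by linarith) ht.le]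
  gcongr
  · exact (Metric.ediam_mono inter_subset_left).trans hA
  · exact inter_subset_right

theorem hausdorffContent_le_image {t : ℝ} (ht : 0 < t) {α β : ℝ} (hα : α ≠ 0) {T : ℝ → ℝ}
    (hT : ∀ x, T x = α * x + β) (A : Set ℝ) :
    hausdorffContent t A ≤ ENNReal.ofReal (1 / |α|) ^ t * hausdorffContent t (T '' A) := by
  have hα' : 0 < 1 / |α| := by positivity
  refine le_mul_hausdorffContent ht
    (ENNReal.rpow_pos (ENNReal.ofReal_pos.2 hα') ENNReal.ofReal_ne_top).ne'
    (ENNReal.rpow_ne_top_of_nonneg ht.le ENNReal.ofReal_ne_top) fun U hU => ?_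
  rw [hausdorffContent_eq ht]
  refine (iInf₂_le (fun i => T ⁻¹' U i) (by
    rw [← preimage_iUnion]; exact image_subset_iff.1 hU)).trans ?_
  rw [← ENNReal.tsum_mul_left]
  refine ENNReal.tsum_le_tsum fun i => ?_
  rw [← ENNReal.mul_rpow_of_nonneg _ _ ht.le]
  refine ENNReal.rpow_le_rpow (Metric.ediam_le fun x hx y hy => ?_) ht.le
  refine le_trans (le_of_eq ?_) (mul_le_mul_right (Metric.edist_le_ediam_of_mem (s := U i) hx hy) _)
  rw [edist_dist, edist_dist, ← ENNReal.ofReal_mul hα'.le, Real.dist_eq, Real.dist_eq, hT, hT,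
    add_sub_add_right_eq_sub, ← mul_sub, abs_mul, ← mul_assoc,
    one_div_mul_cancel (abs_ne_zero.2 hα), one_mul]

namespace ExpandingFullShift

theorem exists_cylMeasureZ_le_hausdorffContent (E : ExpandingFullShift) {K : ℝ} (hK : 1 ≤ K)
    (hbd : E.HasBoundedDistortion K) {s : ℝ} (hs : 0 < s) :
    ∃ M : ℕ, 0 < M ∧ ∀ A : Set ℝ, Metric.ediam A ≤ 1 →
      E.cylMeasureZ s A ≤ M * hausdorffContent s A := by
  obtain ⟨M, hM, h⟩ := E.exists_cylOuterMeasure_le_ediam hK hbd hs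
  refine ⟨M, hM, fun A hA => ?_⟩
  refine le_mul_hausdorffContent hs (by exact_mod_cast hM.ne') (ENNReal.natCast_ne_top M)
    fun U hU => ?_
  refine (E.cylMeasureZ_le_cylOuterMeasure hK hbd hs A).trans ?_
  have hsub : A ⊆ ⋃ i, A ∩ U i := by
    rw [← inter_iUnion]
    exact subset_inter subset_rfl hU
  refine (measure_mono hsub).trans ((measure_iUnion_le _).trans ?_)
  rw [← ENNReal.tsum_mul_left]
  refine ENNReal.tsum_le_tsum fun i => ?_
  refine (h _ ((Metric.ediam_mono inter_subset_left).trans hA)).trans ?_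
  gcongr
  exact inter_subset_right

theorem cylMeasureZ_mono (E : ExpandingFullShift) (s : ℝ) {A B : Set ℝ} (h : A ⊆ B) :
    E.cylMeasureZ s A ≤ E.cylMeasureZ s B :=
  le_iInf₂ fun c hc => le_iInf fun hB => iInf₂_le_of_le c hc (iInf_le _ (h.trans hB))

/-- A set which is large in every cylinder has similar copies which are large in every dyadic
interval. -/
theorem exists_le_hausdorffContent_image (E : ExpandingFullShift) {K : ℝ} (hK : 1 ≤ K)
    (hbd : E.HasBoundedDistortion K) {s c t : ℝ} (hc : 0 < c) (ht : 0 < t) (hts : t ≤ s)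
    {G : Set ℝ} (hG : ∀ C, E.IsCylinderZ C →
      ENNReal.ofReal c * volume C ^ s ≤ E.cylMeasureZ s (G ∩ C))
    {T : ℝ → ℝ} (hT : IsSimilarity T) :
    ∃ a : ℝ, 0 < a ∧ ∀ n k,
      ENNReal.ofReal (a * ((1 / 2) ^ t) ^ n) ≤ hausdorffContent t (T '' G ∩ dyadicCell n k) := by
  obtain ⟨α, β, hα, hTx⟩ := hT
  have hα' : 0 < |α| := abs_pos.2 hα
  obtain ⟨η, hη0, hη1, hη⟩ := E.exists_ratio_bound hK hbd
  obtain ⟨M, hM, hMA⟩ := E.exists_cylMeasureZ_le_hausdorffContent hK hbd (ht.trans_le hts)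
  have hM' : (0:ℝ) < M := by exact_mod_cast hM
  set ρ : ℝ := min 1 (1 / |α|) with hρ
  have hρ0 : 0 < ρ := lt_min one_pos (by positivity)
  have hρ1 : ρ ≤ 1 := min_le_left _ _
  have hαρ : |α| * ρ ≤ 1 := by
    have h : ρ ≤ 1 / |α| := min_le_right _ _
    rwa [le_div_iff₀ hα', mul_comm] at h
  refine ⟨c / M * (|α| * (η * (ρ / 4))) ^ t, by positivity, fun n k => ?_⟩
  have hpow : (0:ℝ) < (1 / 2) ^ n := by positivity
  have hpow1 : ((1:ℝ) / 2) ^ n ≤ 1 := pow_le_one₀ (by norm_num) (by norm_num)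
  have h2pow : ((1:ℝ) / 2) ^ n * 2 ^ n = 1 := by rw [← mul_pow]; norm_num
  set d : ℝ := ρ / 4 * (1 / 2) ^ n with hd
  have hd0 : 0 < d := by positivity
  have hd1 : d ≤ 1 := by nlinarith
  set x : ℝ := ((k + 1 / 2) * (1 / 2) ^ n - β) / α with hx
  obtain ⟨N, hN, hNη⟩ := E.exists_isStop hη0 hη1 hη hd0 hd1 x
  set v : ℝ := E.len (E.word N x) with hv
  have hv0 : 0 < v := lt_of_lt_of_le (by positivity) hNη
  have hTxm : T x = (k + 1 / 2) * (1 / 2) ^ n := by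
    rw [hTx, hx]
    field_simp
    ring
  have hcell : T '' E.pointCylinder N x ⊆ dyadicCell n k := by
    rintro _ ⟨y, hy, rfl⟩
    have h1 := E.abs_sub_le_of_mem_pointCylinder hy (E.self_mem_pointCylinder N x)
    have h2 : |T y - T x| ≤ 1 / 4 * (1 / 2) ^ n := by
      rw [hTx, hTx, add_sub_add_right_eq_sub, ← mul_sub, abs_mul]
      calc |α| * |y - x| ≤ |α| * d := mul_le_mul_of_nonneg_left (h1.trans hN.1) hα'.le
        _ = |α| * ρ * (1 / 4 * (1 / 2) ^ n) := by rw [hd]; ring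
        _ ≤ 1 / 4 * (1 / 2) ^ n := mul_le_of_le_one_left (by positivity) hαρ
    have h3 : |T y * 2 ^ n - (k + 1 / 2)| ≤ 1 / 4 := by
      have h4 : T y * 2 ^ n - (k + 1 / 2) = (T y - T x) * 2 ^ n := by
        rw [hTxm]
        linear_combination (k + 1 / 2 : ℝ) * h2pow
      rw [h4, abs_mul, abs_of_pos (by positivity : (0:ℝ) < 2 ^ n)]
      calc |T y - T x| * 2 ^ n ≤ 1 / 4 * (1 / 2) ^ n * 2 ^ n := by gcongr
        _ = 1 / 4 := by rw [mul_assoc, h2pow, mul_one]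
    rw [abs_le] at h3
    change ⌊T y * 2 ^ n⌋ = k
    rw [Int.floor_eq_iff]
    constructor <;> linarith
  have hdiam : Metric.ediam (G ∩ E.pointCylinder N x) ≤ ENNReal.ofReal v := by
    refine Metric.ediam_le fun y hy z hz => ?_
    rw [edist_dist, Real.dist_eq]
    exact ENNReal.ofReal_le_ofReal (E.abs_sub_le_of_mem_pointCylinder hy.2 hz.2)
  have hchain : ENNReal.ofReal (c * v ^ s) ≤ ENNReal.ofReal (M * v ^ (s - t) * (1 / |α|) ^ t) *
      hausdorffContent t (T '' G ∩ dyadicCell n k) := by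
    have h1 := hG _ (E.isCylinderZ_pointCylinder N x)
    rw [volume_pointCylinder, ENNReal.ofReal_rpow_of_pos hv0, ← ENNReal.ofReal_mul hc.le] at h1
    have hle1 : Metric.ediam (G ∩ E.pointCylinder N x) ≤ 1 :=
      hdiam.trans (ENNReal.ofReal_le_one.2 (hN.1.trans hd1))
    have h2 := hausdorffContent_le_rpow_mul ht hts hv0 hdiam
    have h3 := hausdorffContent_le_image ht hα hTx (G ∩ E.pointCylinder N x)
    have h4 : hausdorffContent t (T '' (G ∩ E.pointCylinder N x)) ≤
        hausdorffContent t (T '' G ∩ dyadicCell n k) :=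
      measure_mono ((image_inter_subset _ _ _).trans (inter_subset_inter_right _ hcell))
    rw [ENNReal.ofReal_mul (p := M * v ^ (s - t)) (by positivity), ENNReal.ofReal_mul hM'.le,
      ENNReal.ofReal_natCast, ← ENNReal.ofReal_rpow_of_pos hv0,
      ← ENNReal.ofReal_rpow_of_pos (by positivity), mul_assoc, mul_assoc]
    refine h1.trans ((hMA _ hle1).trans ?_)
    gcongr
    refine h2.trans ?_
    gcongr
    exact h3.trans (by gcongr)
  have hdiv := ENNReal.div_le_of_le_mul' hchain
  rw [← ENNReal.ofReal_div_of_pos (by positivity)] at hdiv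
  refine (ENNReal.ofReal_le_ofReal ?_).trans hdiv
  have hquot : c * v ^ s / (M * v ^ (s - t) * (1 / |α|) ^ t) = c / M * (|α| * v) ^ t := by
    rw [Real.mul_rpow hα'.le hv0.le, Real.div_rpow zero_le_one hα'.le, Real.one_rpow,
      Real.rpow_sub hv0]
    have := Real.rpow_pos_of_pos hv0 s
    have := Real.rpow_pos_of_pos hv0 t
    have := Real.rpow_pos_of_pos hα' t
    field_simp
  rw [hquot, Real.rpow_pow_comm (by norm_num), mul_assoc, ← Real.mul_rpow (by positivity)
    (by positivity)]
  have hlow : |α| * (η * (ρ / 4)) * (1 / 2) ^ n ≤ |α| * v := by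
    have h := mul_le_mul_of_nonneg_left hNη hα'.le
    rw [hd] at h
    linarith
  gcongr

end ExpandingFullShift

theorem IsSimilarity.injective {T : ℝ → ℝ} (hT : IsSimilarity T) : Function.Injective T := by
  obtain ⟨α, β, hα, hTx⟩ := hT
  intro x y hxy
  rw [hTx, hTx] at hxy
  exact mul_left_cancel₀ hα (add_right_cancel hxy)

theorem IsSimilarity.isOpenMap {T : ℝ → ℝ} (hT : IsSimilarity T) : IsOpenMap T := by
  obtain ⟨α, β, hα, hTx⟩ := hT
  have h : T = (Homeomorph.mulLeft₀ α hα).trans (Homeomorph.addRight β) := funext hTx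
  rw [h]
  exact Homeomorph.isOpenMap _

open ExpandingFullShift in
/-- if `(F_k)` are open sets with
`liminf_k N^s_∞(F_k ∩ C) ≥ c|C|^s` for every cylinder `C` (of the cylinder structure
extended periodically to `ℝ`), then `limsup_k F_k = ⋂_m ⋃_{k≥m} F_k ∈ 𝒢^s`. -/
theorem limsup_open_mem_falconerClass (E : ExpandingFullShift) (K : ℝ) (hK : 1 ≤ K)
    (hbd : E.HasBoundedDistortion K)
    (F : ℕ → Set ℝ) (hFopen : ∀ k, IsOpen (F k))
    (s c : ℝ) (hs0 : 0 < s) (hs1 : s ≤ 1) (hc : 0 < c)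
    (h : ∀ C : Set ℝ, E.IsCylinderZ C →
      ENNReal.ofReal c * volume C ^ s ≤ atTop.liminf (fun k => E.cylMeasureZ s (F k ∩ C))) :
    (⋂ m : ℕ, ⋃ k, ⋃ (_ : k ≥ m), F k) ∈ falconerClass s := by
  set G : ℕ → Set ℝ := fun m => ⋃ k, ⋃ (_ : k ≥ m), F k with hGdef
  have hGopen : ∀ m, IsOpen (G m) := fun m =>
    isOpen_iUnion fun k => isOpen_iUnion fun _ => hFopen k
  have hG : ∀ m C, E.IsCylinderZ C →
      ENNReal.ofReal c * volume C ^ s ≤ E.cylMeasureZ s (G m ∩ C) := by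
    intro m C hC
    refine (h C hC).trans ((liminf_le_liminf ?_).trans_eq
      (liminf_const (E.cylMeasureZ s (G m ∩ C))))
    filter_upwards [eventually_ge_atTop m] with k hk
    exact E.cylMeasureZ_mono s (inter_subset_inter_left _
      (subset_iUnion₂_of_subset k hk subset_rfl))
  refine ⟨IsGδ.iInter_of_isOpen hGopen, fun T hT => ?_⟩
  set V : ℕ → Set ℝ := fun j => T j.unpair.1 '' G j.unpair.2 with hV
  have hsub : ⋂ j, V j ⊆ ⋂ i, T i '' ⋂ m, G m := by
    intro x hx
    refine mem_iInter.2 fun i => ?_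
    rw [(hT i).injective.injOn.image_iInter_eq]
    refine mem_iInter.2 fun m => ?_
    have hxj := mem_iInter.1 hx (Nat.pair i m)
    simpa only [hV, Nat.unpair_pair] using hxj
  refine le_trans ?_ (dimH_mono hsub)
  refine le_of_forall_lt fun r hr => ?_
  obtain ⟨t, hrt, hts⟩ := exists_between hr
  have htop : t ≠ ⊤ := hts.ne_top
  have ht0 : 0 < t.toReal := ENNReal.toReal_pos (zero_le.trans_lt hrt).ne' htop
  have hts' : t.toReal < s := (ENNReal.lt_ofReal_iff_toReal_lt htop).1 hts
  have hpos := hausdorffContent_iInter_pos ht0 (hts'.trans_le hs1)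
    (fun j => (hT j.unpair.1).isOpenMap _ (hGopen j.unpair.2))
    (fun j => E.exists_le_hausdorffContent_image hK hbd hc ht0 hts'.le (hG j.unpair.2)
      (hT j.unpair.1))
  have hdim := le_dimH_of_hausdorffContent_pos ht0
    (lt_of_lt_of_le (ENNReal.ofReal_pos.2 (by norm_num)) hpos)
  rw [ENNReal.ofReal_toReal htop] at hdim
  exact hrt.trans_le hdim
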